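/- arXiv:1302.4295 — 2 statements merged into one kernel-verified Lean document; each statement's English description precedes it below -/
import Mathlib

section
/- There exists a universal constant c > 0 such that for all integers q ≥ 2, n ≥ 1 and 1 ≤ t ≤ n there exists an orthogonal array T of alphabet size q, length n and strength t satisfying |T| ≤ (c·q·n/t)^(c·t). -/
/-- A subset `T ⊆ [q]^n` is an orthogonal array of alphabet size `q`, length `n` and
strength `t` if for any `t` distinct indices and any `t` values, the number of rows of `T`
agreeing with these values on these indices equals `q^(-t)·|T|`. -/
def IsOrthogonalArray (q n t : ℕ) (T : Finset (Fin n → Fin q)) : Prop :=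
  ∀ idx : Fin t → Fin n, Function.Injective idx →
    ∀ val : Fin t → Fin q,
      (T.filter fun x => ∀ j, x (idx j) = val j).card * q ^ t = T.card

/-- A family `X` of words over `α` is `t`-wise independent and uniform: on any at most `t`
positions every pattern is attained equally often. -/
def IsUniformFamily {Ω ι α : Type} (t : ℕ) (X : Ω → ι → α) : Prop :=
  ∀ S : Finset ι, S.card ≤ t → ∀ v : ι → α,
    Nat.card {ω // ∀ i ∈ S, X ω i = v i} * Nat.card α ^ S.card = Nat.card Ω

/-- A function `h` of words is `t`-resilient: its value is uniformly distributed even after any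
at most `t` letters of the input are fixed. -/
def IsResilient {ι α β : Type} (t : ℕ) (h : (ι → α) → β) : Prop :=
  ∀ S : Finset ι, S.card ≤ t → ∀ (v : ι → α) (b : β),
    Nat.card {x // h x = b ∧ ∀ i ∈ S, x i = v i} * (Nat.card β * Nat.card α ^ S.card) =
      Nat.card (ι → α)

theorem card_fiber_mul_card_of_surjective {A B : Type} [AddCommGroup A] [AddCommGroup B]
    [Finite A] [Finite B] (f : A →+ B) (hf : Function.Surjective f) (b : B) :
    Nat.card {a // f a = b} * Nat.card B = Nat.card A := by
  classical
  cases nonempty_fintype A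
  cases nonempty_fintype B
  have key : ∀ c, (Finset.univ.filter fun a => f a = c).card =
      (Finset.univ.filter fun a => f a = b).card := fun c =>
    AddMonoidHom.card_fiber_eq_of_mem_range f (hf c) (hf b)
  have h := Finset.card_eq_sum_card_fiberwise (s := (Finset.univ : Finset A))
    (t := (Finset.univ : Finset B)) (f := f) (fun _ _ => Finset.mem_univ _)
  rw [Finset.sum_congr rfl fun c _ => key c] at h
  simp only [Finset.sum_const, smul_eq_mul, Finset.card_univ] at h
  rw [Nat.card_eq_fintype_card, Nat.card_eq_fintype_card, Nat.card_eq_fintype_card,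
    Fintype.card_subtype, h, mul_comm]

theorem sum_comp_mul_card_of_surjective {A B : Type} [AddCommGroup A] [AddCommGroup B]
    [Fintype A] [Fintype B] (f : A →+ B) (hf : Function.Surjective f) (F : B → ℕ) :
    (∑ a, F (f a)) * Fintype.card B = Fintype.card A * ∑ b, F b := by
  classical
  have h := Finset.sum_fiberwise (s := (Finset.univ : Finset A)) (g := f) (f := fun a => F (f a))
  rw [← h, Finset.sum_mul, Finset.mul_sum]
  refine Finset.sum_congr rfl fun b _ => ?_
  rw [Finset.sum_congr rfl (g := fun _ => F b) (by simp +contextual), Finset.sum_const,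
    smul_eq_mul]
  have := card_fiber_mul_card_of_surjective f hf b
  rw [Nat.card_eq_fintype_card, Nat.card_eq_fintype_card, Nat.card_eq_fintype_card,
    Fintype.card_subtype] at this
  rw [← this]; ring

/-- The letter at position `i` of the codeword of `u` in the code with columns `a`. -/
def codeword {K : Type} [Field K] {k n : ℕ} (a : Fin n → Fin k → K) (u : Fin k → K) (i : Fin n) :
    K := u ⬝ᵥ a i

/-- Any at most `t` of the columns `a` are linearly independent. -/
def IsIndependentColumns {K : Type} [Field K] {k n : ℕ} (t : ℕ) (a : Fin n → Fin k → K) : Prop :=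
  ∀ w : Fin n → K, w ≠ 0 → (∃ S : Finset (Fin n), S.card = t ∧ ∀ i ∉ S, w i = 0) →
    ∑ i, w i • a i ≠ 0

/-- The codeword of `u`, restricted to the positions in `S`, as a linear map. -/
def restrictedCodeword {K : Type} [Field K] {k n : ℕ} (a : Fin n → Fin k → K)
    (S : Finset (Fin n)) : (Fin k → K) →ₗ[K] (S → K) where
  toFun u i := codeword a u i
  map_add' u v := by ext i; simp [codeword]
  map_smul' c u := by ext i; simp [codeword]

theorem IsIndependentColumns.surjective {K : Type} [Field K] {k n t : ℕ}
    {a : Fin n → Fin k → K} (ha : IsIndependentColumns t a) (htn : t ≤ n)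
    (S : Finset (Fin n)) (hS : S.card ≤ t) :
    Function.Surjective (restrictedCodeword a S) := by
  classical
  rw [← LinearMap.range_eq_top]
  by_contra hne
  obtain ⟨f, hf0, hf⟩ := Submodule.exists_le_ker_of_lt_top _ (lt_top_iff_ne_top.2 hne)
  obtain ⟨S', hSS', hS'⟩ := Finset.exists_superset_card_eq hS (by simpa using htn)
  let w : Fin n → K := fun i => if h : i ∈ S then f (Pi.single ⟨i, h⟩ 1) else 0
  have hfw : ∀ x : S → K, f x = ∑ i : S, x i * w i := by
    intro x
    conv_lhs => rw [LinearMap.pi_apply_eq_sum_univ f x]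
    refine Finset.sum_congr rfl fun i _ => ?_
    simp only [w, i.2, dite_true, smul_eq_mul]
    congr 2
    ext j
    simp [Pi.single_apply, eq_comm]
  refine ha w ?_ ⟨S', hS', fun i hi => ?_⟩ ?_
  · intro hw
    apply hf0
    ext x
    simp [hfw, hw]
  · simp only [w]
    rw [dif_neg fun h => hi (hSS' h)]
  · have hsum : ∀ u : Fin k → K, u ⬝ᵥ (∑ i, w i • a i) = 0 := by
      intro u
      have h1 : f (restrictedCodeword a S u) = 0 := hf ⟨u, rfl⟩
      rw [hfw] at h1
      rw [dotProduct_sum, ← h1, Finset.univ_eq_attach]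
      change _ = ∑ i ∈ S.attach, codeword a u i * w i
      rw [Finset.sum_attach S (fun i => codeword a u i * w i)]
      symm
      refine (Finset.sum_subset (Finset.subset_univ S) fun i _ hi => ?_).trans ?_
      · simp [w, hi]
      · exact Finset.sum_congr rfl fun i _ => by simp [codeword, mul_comm]
    exact dotProduct_eq_zero _ fun u => by rw [dotProduct_comm]; exact hsum u

theorem card_not_isIndependentColumns_mul_le {K : Type} [Field K] [Fintype K] (k n t : ℕ) :
    Nat.card {a : Fin n → Fin k → K // ¬ IsIndependentColumns t a} * Fintype.card K ^ k ≤
      n.choose t * Fintype.card K ^ t * Fintype.card K ^ (k * n) := by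
  classical
  rw [Nat.card_eq_fintype_card, Fintype.card_subtype]
  let W : Finset (Fin n → K) := (Finset.powersetCard t Finset.univ).biUnion fun S =>
    Fintype.piFinset fun i => if i ∈ S then Finset.univ else {0}
  have hW : W.card ≤ n.choose t * Fintype.card K ^ t := by
    refine (Finset.card_biUnion_le_card_mul _ _ (Fintype.card K ^ t) ?_).trans (by simp)
    intro S hS
    rw [Finset.mem_powersetCard] at hS
    rw [Fintype.card_piFinset]
    simp only [apply_ite Finset.card, Finset.card_univ, Finset.card_singleton]
    simp [hS.2]
  have hsub : (Finset.univ.filter fun a : Fin n → Fin k → K => ¬ IsIndependentColumns t a) ⊆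
      (W.filter (· ≠ 0)).biUnion fun w => Finset.univ.filter fun a => ∑ i, w i • a i = 0 := by
    intro a ha
    simp only [IsIndependentColumns, Finset.mem_filter, Finset.mem_univ, true_and, not_forall,
      not_not] at ha
    obtain ⟨w, hw0, ⟨S, hS, hwS⟩, hsum⟩ := ha
    simp only [Finset.mem_biUnion, Finset.mem_filter, Finset.mem_univ, true_and, W,
      Finset.mem_powersetCard, Fintype.mem_piFinset]
    refine ⟨w, ⟨⟨S, ⟨Finset.subset_univ _, hS⟩, fun i => ?_⟩, hw0⟩, hsum⟩
    by_cases hi : i ∈ S <;> simp [hi, hwS]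
  have hfib : ∀ w : Fin n → K, w ≠ 0 →
      (Finset.univ.filter fun a : Fin n → Fin k → K => ∑ i, w i • a i = 0).card *
        Fintype.card K ^ k = Fintype.card K ^ (k * n) := by
    intro w hw
    obtain ⟨i₀, hi₀⟩ := Function.ne_iff.1 hw
    let f : (Fin n → Fin k → K) →+ (Fin k → K) :=
      { toFun := fun a => ∑ i, w i • a i
        map_zero' := by simp
        map_add' := fun a b => by simp [Finset.sum_add_distrib] }
    have hf : Function.Surjective f := by
      intro b
      refine ⟨Pi.single i₀ ((w i₀)⁻¹ • b), ?_⟩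
      change ∑ i, w i • (Pi.single i₀ ((w i₀)⁻¹ • b) : Fin n → Fin k → K) i = b
      rw [Finset.sum_eq_single i₀]
      · rw [Pi.single_eq_same, smul_smul, mul_inv_cancel₀ hi₀, one_smul]
      · intro i _ hi
        rw [Pi.single_eq_of_ne hi, smul_zero]
      · simp
    have := card_fiber_mul_card_of_surjective f hf 0
    rw [Nat.card_eq_fintype_card, Nat.card_eq_fintype_card, Nat.card_eq_fintype_card,
      Fintype.card_subtype] at this
    simpa [f, pow_mul] using this
  calc _ ≤ (∑ w ∈ W.filter (· ≠ 0),
        (Finset.univ.filter fun a : Fin n → Fin k → K => ∑ i, w i • a i = 0).card) *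
          Fintype.card K ^ k :=
        Nat.mul_le_mul_right _ ((Finset.card_le_card hsub).trans Finset.card_biUnion_le)
    _ = ∑ w ∈ W.filter (· ≠ 0), Fintype.card K ^ (k * n) := by
        rw [Finset.sum_mul]
        exact Finset.sum_congr rfl fun w hw => hfib w (Finset.mem_filter.1 hw).2
    _ ≤ _ := by
        rw [Finset.sum_const, smul_eq_mul]
        exact Nat.mul_le_mul_right _ ((Finset.card_filter_le _ _).trans hW)

theorem card_codewords_mem_mul_le {K : Type} [Field K] [Fintype K] (k n m : ℕ) (Z : Finset K) :
    Nat.card {a : Fin n → Fin k → K //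
        ∃ u, u ≠ 0 ∧ ∃ J : Finset (Fin n), J.card = m ∧ ∀ i ∈ J, codeword a u i ∈ Z} *
      Fintype.card K ^ m ≤
      Fintype.card K ^ k * n.choose m * Z.card ^ m * Fintype.card K ^ (k * n) := by
  classical
  rw [Nat.card_eq_fintype_card, Fintype.card_subtype]
  let P : Finset ((Fin k → K) × Finset (Fin n)) :=
    (Finset.univ.filter (· ≠ 0)) ×ˢ Finset.powersetCard m Finset.univ
  let E : (Fin k → K) × Finset (Fin n) → Finset (Fin n → Fin k → K) := fun p =>
    Fintype.piFinset fun i => if i ∈ p.2 then Finset.univ.filter fun b => p.1 ⬝ᵥ b ∈ Z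
      else Finset.univ
  have hP : P.card ≤ Fintype.card K ^ k * n.choose m := by
    rw [Finset.card_product]
    refine Nat.mul_le_mul ((Finset.card_filter_le _ _).trans (by simp)) (by simp)
  have hE : ∀ p ∈ P, (E p).card * Fintype.card K ^ m = Z.card ^ m * Fintype.card K ^ (k * n) := by
    rintro ⟨u, J⟩ hp
    simp only [P, Finset.mem_product, Finset.mem_filter, Finset.mem_univ, true_and,
      Finset.mem_powersetCard] at hp
    obtain ⟨hu, -, hJ⟩ := hp
    obtain ⟨i₀, hi₀⟩ := Function.ne_iff.1 hu
    let f : (Fin k → K) →+ K :=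
      { toFun := fun b => u ⬝ᵥ b
        map_zero' := by simp
        map_add' := fun a b => by simp }
    have hf : Function.Surjective f := fun c =>
      ⟨Pi.single i₀ ((u i₀)⁻¹ * c), by
        change u ⬝ᵥ Pi.single i₀ ((u i₀)⁻¹ * c) = c
        rw [dotProduct_single, mul_inv_cancel_left₀ hi₀]⟩
    have h1 := sum_comp_mul_card_of_surjective f hf (fun c => if c ∈ Z then 1 else 0)
    have h2 : (Finset.univ.filter fun b => u ⬝ᵥ b ∈ Z).card * Fintype.card K =
        Fintype.card K ^ k * Z.card := by
      rw [← Finset.card_filter, ← Finset.card_filter] at h1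
      simpa [f] using h1
    have hJn : J.card ≤ n := by simpa using Finset.card_le_univ J
    simp only [E]
    rw [Fintype.card_piFinset]
    simp only [apply_ite Finset.card, Finset.prod_ite, Finset.prod_const]
    have e1 : (Finset.univ.filter fun i => i ∈ J).card = m := by simp [hJ]
    have e2 : (Finset.univ.filter fun i => i ∉ J).card = n - m := by
      rw [Finset.filter_not, Finset.filter_univ_mem, ← Finset.compl_eq_univ_sdiff,
        Finset.card_compl, hJ, Fintype.card_fin]
    rw [e1, e2, mul_right_comm, ← mul_pow, h2]
    rw [hJ] at hJn
    simp only [Finset.card_univ, Fintype.card_pi, Finset.prod_const, Fintype.card_fin]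
    rw [mul_pow, mul_right_comm, ← pow_add, Nat.add_sub_cancel' hJn, ← pow_mul, mul_comm]
  have hsub : (Finset.univ.filter fun a : Fin n → Fin k → K =>
      ∃ u, u ≠ 0 ∧ ∃ J : Finset (Fin n), J.card = m ∧ ∀ i ∈ J, codeword a u i ∈ Z) ⊆
      P.biUnion E := by
    intro a ha
    simp only [Finset.mem_filter, Finset.mem_univ, true_and] at ha
    obtain ⟨u, hu, J, hJ, hZ⟩ := ha
    simp only [Finset.mem_biUnion, P, E, Finset.mem_product, Finset.mem_filter, Finset.mem_univ,
      true_and, Finset.mem_powersetCard, Fintype.mem_piFinset]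
    refine ⟨(u, J), ⟨hu, Finset.subset_univ _, hJ⟩, fun i => ?_⟩
    by_cases hi : i ∈ J
    · simpa [hi, codeword] using hZ i hi
    · simp [hi]
  calc _ ≤ (∑ p ∈ P, (E p).card) * Fintype.card K ^ m :=
        Nat.mul_le_mul_right _ ((Finset.card_le_card hsub).trans Finset.card_biUnion_le)
    _ = ∑ p ∈ P, Z.card ^ m * Fintype.card K ^ (k * n) := by
        rw [Finset.sum_mul]
        exact Finset.sum_congr rfl hE
    _ ≤ _ := by
        rw [Finset.sum_const, smul_eq_mul, mul_assoc (_ * _)]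
        exact Nat.mul_le_mul_right _ hP

theorem exists_columns {K : Type} [Field K] [Fintype K] (k n t m : ℕ) (Z : Finset K)
    (h₁ : 2 * (n.choose t * Fintype.card K ^ t) < Fintype.card K ^ k)
    (h₂ : 2 * (Fintype.card K ^ k * n.choose m * Z.card ^ m) ≤ Fintype.card K ^ m) :
    ∃ a : Fin n → Fin k → K, IsIndependentColumns t a ∧
      ∀ u, u ≠ 0 → ∀ J : Finset (Fin n), (∀ i ∈ J, codeword a u i ∈ Z) → J.card ≤ m := by
  classical
  by_contra! hcon
  have b₁ := card_not_isIndependentColumns_mul_le (K := K) k n t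
  have b₂ := card_codewords_mem_mul_le (K := K) k n m Z
  rw [Nat.card_eq_fintype_card, Fintype.card_subtype] at b₁ b₂
  set A := Finset.univ.filter fun a : Fin n → Fin k → K => ¬ IsIndependentColumns t a
  set B := Finset.univ.filter fun a : Fin n → Fin k → K =>
    ∃ u, u ≠ 0 ∧ ∃ J : Finset (Fin n), J.card = m ∧ ∀ i ∈ J, codeword a u i ∈ Z
  have hAB : Finset.univ ⊆ A ∪ B := by
    intro a _
    by_cases ha : IsIndependentColumns t a
    · obtain ⟨u, hu, J, hJ, hm⟩ := hcon a ha
      obtain ⟨J', hJ', hc⟩ := Finset.exists_subset_card_eq hm.le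
      exact Finset.mem_union_right _ (Finset.mem_filter.2
        ⟨Finset.mem_univ _, u, hu, J', hc, fun i hi => hJ i (hJ' hi)⟩)
    · exact Finset.mem_union_left _ (Finset.mem_filter.2 ⟨Finset.mem_univ _, ha⟩)
  have hcard := (Finset.card_le_card hAB).trans (Finset.card_union_le _ _)
  have hu : (Finset.univ : Finset (Fin n → Fin k → K)).card = Fintype.card K ^ (k * n) := by
    simp [pow_mul]
  rw [hu] at hcard
  have hK : 0 < Fintype.card K := Fintype.card_pos
  set Q := Fintype.card K
  have hQ : 0 < Q ^ (k * n) := by positivity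
  have c₁ : 2 * A.card < Q ^ (k * n) := by
    refine lt_of_mul_lt_mul_right (a := Q ^ k) ?_ (Nat.zero_le _)
    nlinarith
  have c₂ : 2 * B.card ≤ Q ^ (k * n) := by
    refine le_of_mul_le_mul_right (a := Q ^ m) ?_ (by positivity)
    nlinarith
  omega

theorem exists_balanced_label (K α : Type) [Fintype K] [Fintype α] [Nonempty α] (z : K) :
    ∃ (l : K → Option α) (s r : ℕ), l z = none ∧ r ≤ Fintype.card α ∧
      ∀ g : Option α → ℕ, ∑ x, g (l x) = s * ∑ a, g (some a) + r * g none := by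
  classical
  have hK : 0 < Fintype.card K := Fintype.card_pos_iff.2 ⟨z⟩
  have hα : 0 < Fintype.card α := Fintype.card_pos
  let s := (Fintype.card K - 1) / Fintype.card α
  let r := (Fintype.card K - 1) % Fintype.card α + 1
  have hcard : Fintype.card K = Fintype.card ((Fin s × α) ⊕ Fin r) := by
    have := Nat.div_add_mod (Fintype.card K - 1) (Fintype.card α)
    simp only [Fintype.card_sum, Fintype.card_prod, Fintype.card_fin, s, r]
    rw [mul_comm (_ / _)]
    omega
  let e₀ := Fintype.equivOfCardEq hcard
  let e : K ≃ (Fin s × α) ⊕ Fin r := e₀.trans (Equiv.swap (e₀ z) (Sum.inr 0))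
  refine ⟨fun x => (e x).elim (fun p => some p.2) fun _ => none, s, r, ?_, ?_, fun g => ?_⟩
  · simp [e]
  · exact Nat.mod_lt _ hα
  · rw [Fintype.sum_equiv e _
      (fun y => g (y.elim (fun p => some p.2) fun _ => none)) fun _ => rfl]
    simp [Fintype.sum_sum_type, Fintype.sum_prod_type]

theorem card_agree_on_injOn_mul {ι α : Type} {m : ℕ} [Finite α] (B : Finset ι) (f : ι → Fin m)
    (hf : Set.InjOn f B) (v : ι → α) :
    Nat.card {τ : Fin m → α // ∀ i ∈ B, τ (f i) = v i} * Nat.card α ^ B.card =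
      Nat.card α ^ m := by
  classical
  cases nonempty_fintype α
  rw [Nat.card_eq_fintype_card, Nat.card_eq_fintype_card]
  have hset : Fintype.card {τ : Fin m → α // ∀ i ∈ B, τ (f i) = v i} =
      ∏ j : Fin m, if j ∈ B.image f then 1 else Fintype.card α := by
    rcases isEmpty_or_nonempty ι with hι | hι
    · have : B = ∅ := Finset.eq_empty_of_isEmpty B
      subst this
      simp
    rw [Fintype.card_subtype]
    have : (Finset.univ.filter fun τ : Fin m → α => ∀ i ∈ B, τ (f i) = v i) =
        Fintype.piFinset fun j => if j ∈ B.image f then {v (Function.invFunOn f B j)}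
          else Finset.univ := by
      ext τ
      simp only [Finset.mem_filter, Finset.mem_univ, true_and, Fintype.mem_piFinset]
      constructor
      · intro h j
        by_cases hj : j ∈ B.image f
        · rw [if_pos hj, Finset.mem_singleton]
          have hj' : ∃ i ∈ (B : Set ι), f i = j := by simpa using hj
          rw [← h _ (Function.invFunOn_mem hj'), Function.invFunOn_eq hj']
        · simp [hj]
      · intro h i hi
        have := h (f i)
        rw [if_pos (Finset.mem_image_of_mem f hi), Finset.mem_singleton] at this
        rw [this, hf.leftInvOn_invFunOn hi]
    rw [this, Fintype.card_piFinset]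
    refine Finset.prod_congr rfl fun j _ => ?_
    split_ifs <;> simp
  rw [hset, Finset.prod_ite, Finset.prod_const_one, one_mul, Finset.prod_const,
    ← Finset.card_image_of_injOn hf, ← pow_add, Finset.filter_not, Finset.filter_univ_mem,
    ← Finset.compl_eq_univ_sdiff, Finset.card_compl_add_card, Fintype.card_fin]

/-- The word of labels of a codeword, where the letters without a label are replaced by letters
of `τ`. -/
def substitutedWord {K α : Type} [Field K] {k n m : ℕ} (a : Fin n → Fin k → K)
    (l : K → Option α) (f : (Fin k → K) → Fin n → Fin m)
    (p : {u : Fin k → K // u ≠ 0} × (Fin m → α)) (i : Fin n) : α :=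
  (l (codeword a p.1 i)).getD (p.2 (f p.1 i))

theorem isUniformFamily_substitutedWord {K α : Type} [Field K] [Fintype K] [Fintype α]
    {k n m t s r : ℕ} (htn : t ≤ n) {a : Fin n → Fin k → K} (ha : IsIndependentColumns t a)
    {l : K → Option α} (hl0 : l 0 = none)
    (hl : ∀ g : Option α → ℕ, ∑ x, g (l x) = s * ∑ c, g (some c) + r * g none)
    {f : (Fin k → K) → Fin n → Fin m}
    (hf : ∀ u, u ≠ 0 → Set.InjOn (f u) {i | l (codeword a u i) = none}) :
    IsUniformFamily t (substitutedWord a l f) := by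
  classical
  intro S hS v
  let g : Fin n → K → ℕ := fun i x =>
    (l x).elim 1 fun c => if c = v i then Fintype.card α else 0
  have hgsum : ∀ i, ∑ x, g i x = Fintype.card K := by
    intro i
    have h1 := hl (fun o => o.elim 1 fun c => if c = v i then Fintype.card α else 0)
    have h2 := hl (fun _ => 1)
    simp only [Option.elim_some, Option.elim_none, Finset.sum_ite_eq', Finset.mem_univ,
      if_true, Finset.sum_const, Finset.card_univ, smul_eq_mul, mul_one] at h1 h2
    rw [h2]; exact h1
  have hg0 : ∀ i, g i 0 = 1 := fun i => by simp [g, hl0]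
  have hall : ∑ u : Fin k → K, ∏ i ∈ S, g i (codeword a u i) = Fintype.card (Fin k → K) := by
    have h := sum_comp_mul_card_of_surjective (restrictedCodeword a S).toAddMonoidHom
      (ha.surjective htn S hS) (fun y => ∏ i : S, g i (y i))
    have h3 : ∑ y : S → K, ∏ i : S, g i (y i) = Fintype.card (S → K) := by
      rw [← Fintype.prod_sum (fun (i : S) x => g i x)]
      simp [hgsum]
    rw [h3] at h
    have h4 := Nat.eq_of_mul_eq_mul_right Fintype.card_pos h
    rw [← h4]
    refine Finset.sum_congr rfl fun u _ => ?_
    exact (Finset.prod_coe_sort S (fun i => g i (codeword a u i))).symm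
  have hnz : ∑ u : {u : Fin k → K // u ≠ 0}, ∏ i ∈ S, g i (codeword a u i) =
      Fintype.card {u : Fin k → K // u ≠ 0} := by
    have h0 : ∏ i ∈ S, g i (codeword a 0 i) = 1 :=
      Finset.prod_eq_one fun i _ => by simp [codeword, hg0]
    rw [← Fintype.sum_subtype_add_sum_subtype (fun u : Fin k → K => u ≠ 0)] at hall
    have h5 : ∑ u : {u : Fin k → K // ¬ u ≠ 0}, ∏ i ∈ S, g i (codeword a u i) = 1 := by
      let _ : Unique {u : Fin k → K // ¬ u ≠ 0} :=
        { default := ⟨0, by simp⟩, uniq := fun u => Subtype.ext (not_not.1 u.2) }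
      rw [Fintype.sum_unique]
      exact h0
    rw [h5] at hall
    have h6 := Fintype.card_subtype_compl (fun u : Fin k → K => u = 0)
    rw [Fintype.card_subtype_eq] at h6
    change Fintype.card {u : Fin k → K // ¬ u = 0} = _ at h6
    have h7 : Fintype.card {u : Fin k → K // u ≠ 0} = Fintype.card (Fin k → K) - 1 := by
      rw [← h6]
    omega
  have hfib : ∀ u : {u : Fin k → K // u ≠ 0},
      Nat.card {τ : Fin m → α // ∀ i ∈ S, substitutedWord a l f (u, τ) i = v i} *
        Nat.card α ^ S.card = Nat.card α ^ m * ∏ i ∈ S, g i (codeword a u i) := by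
    intro u
    by_cases hbad : ∃ i ∈ S, ∃ c, l (codeword a u i) = some c ∧ c ≠ v i
    · obtain ⟨i, hi, c, hc, hcv⟩ := hbad
      have h1 : g i (codeword a u i) = 0 := by simp [g, hc, hcv]
      rw [Finset.prod_eq_zero hi h1, mul_zero]
      have : IsEmpty {τ : Fin m → α // ∀ i ∈ S, substitutedWord a l f (u, τ) i = v i} :=
        ⟨fun τ => hcv (by simpa [substitutedWord, hc] using τ.2 i hi)⟩
      rw [Nat.card_of_isEmpty, zero_mul]
    · push Not at hbad
      let B := S.filter fun i => l (codeword a u i) = none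
      have hB := card_agree_on_injOn_mul B (f u) ((hf u u.2).mono fun i hi => by
        have := Finset.mem_coe.1 hi
        exact (Finset.mem_filter.1 this).2) v
      have h1 : ∀ τ : Fin m → α, (∀ i ∈ S, substitutedWord a l f (u, τ) i = v i) ↔
          ∀ i ∈ B, τ (f u i) = v i := by
        intro τ
        constructor
        · intro h i hi
          obtain ⟨hiS, hin⟩ := Finset.mem_filter.1 hi
          simpa [substitutedWord, hin] using h i hiS
        · intro h i hi
          rcases hc : l (codeword a u i) with _ | c
          · simpa [substitutedWord, hc] using h i (Finset.mem_filter.2 ⟨hi, hc⟩)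
          · simpa [substitutedWord, hc] using hbad i hi c hc
      have h2 : ∏ i ∈ S, g i (codeword a u i) =
          Nat.card α ^ (S.filter fun i => ¬ l (codeword a u i) = none).card := by
        rw [← Finset.prod_filter_mul_prod_filter_not S (fun i => l (codeword a u i) = none),
          Finset.prod_eq_one, one_mul, Finset.prod_congr rfl (g := fun _ => Nat.card α),
          Finset.prod_const]
        · intro i hi
          obtain ⟨hiS, hin⟩ := Finset.mem_filter.1 hi
          obtain ⟨c, hc⟩ := Option.ne_none_iff_exists'.1 hin
          simp [g, hc, hbad i hiS c hc]
        · intro i hi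
          simp [g, (Finset.mem_filter.1 hi).2]
      rw [Nat.card_congr (Equiv.subtypeEquivRight h1), h2, ← hB, mul_assoc, ← pow_add,
        Finset.card_filter_add_card_filter_not]
  have hsplit : Nat.card {p : {u : Fin k → K // u ≠ 0} × (Fin m → α) //
      ∀ i ∈ S, substitutedWord a l f p i = v i} =
      ∑ u : {u : Fin k → K // u ≠ 0},
        Nat.card {τ : Fin m → α // ∀ i ∈ S, substitutedWord a l f (u, τ) i = v i} := by
    rw [← Nat.card_sigma]
    exact Nat.card_congr
      (Equiv.subtypeProdEquivSigmaSubtype fun u τ => ∀ i ∈ S, substitutedWord a l f (u, τ) i = v i)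
  rw [hsplit, Finset.sum_mul, Finset.sum_congr rfl fun u _ => hfib u, ← Finset.mul_sum, hnz,
    Nat.card_prod, Nat.card_fun, Nat.card_eq_fintype_card (α := {u : Fin k → K // u ≠ 0}),
    Nat.card_eq_fintype_card (α := Fin m), Fintype.card_fin, mul_comm]

/-- Existence of a uniform family whose rows may repeat. -/
theorem exists_isUniformFamily {α : Type} [Fintype α] [Nonempty α] (K : Type) [Field K]
    [Fintype K] {n t m k : ℕ} (htn : t ≤ n) (hk : 0 < k)
    (hm : 0 < m)
    (h₁ : 2 * (n.choose t * Fintype.card K ^ t) < Fintype.card K ^ k)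
    (h₂ : 2 * (Fintype.card K ^ k * n.choose m * Fintype.card α ^ m) ≤ Fintype.card K ^ m) :
    ∃ (Ω : Type) (_ : Finite Ω) (_ : Nonempty Ω) (X : Ω → Fin n → α), IsUniformFamily t X ∧
      Nat.card Ω ≤ Fintype.card K ^ k * Fintype.card α ^ m := by
  classical
  obtain ⟨l, s, r, hl0, hr, hl⟩ := exists_balanced_label K α 0
  let Z : Finset K := Finset.univ.filter fun x => l x = none
  have hZ : Z.card = r := by
    have := hl (fun o => if o = none then 1 else 0)
    rw [← Finset.card_filter] at this
    simpa [Z] using this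
  have h₂' : 2 * (Fintype.card K ^ k * n.choose m * Z.card ^ m) ≤ Fintype.card K ^ m := by
    refine le_trans ?_ h₂
    rw [hZ]
    gcongr
  obtain ⟨a, ha, hbad⟩ := exists_columns k n t m Z h₁ h₂'
  have hf : ∀ u : Fin k → K, ∃ f : Fin n → Fin m, u ≠ 0 →
      Set.InjOn f {i | l (codeword a u i) = none} := by
    intro u
    by_cases hu : u = 0
    · exact ⟨fun _ => ⟨0, hm⟩, fun h => absurd hu h⟩
    · let B : Finset (Fin n) := Finset.univ.filter fun i => l (codeword a u i) = none
      have hB : B.card ≤ m := hbad u hu B fun i hi => by simpa [B, Z] using hi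
      obtain ⟨j⟩ := Function.Embedding.nonempty_of_card_le (α := B) (β := Fin m) (by simpa using hB)
      refine ⟨fun i => if h : i ∈ B then j ⟨i, h⟩ else ⟨0, hm⟩, fun _ x hx y hy hxy => ?_⟩
      have hx' : x ∈ B := by simpa [B] using hx
      have hy' : y ∈ B := by simpa [B] using hy
      simp only [dif_pos hx', dif_pos hy'] at hxy
      simpa using j.injective hxy
  choose f hf using hf
  refine ⟨_, inferInstance, ?_, substitutedWord a l f,
    isUniformFamily_substitutedWord htn ha hl0 hl hf, ?_⟩
  · have : Nonempty (Fin k) := ⟨⟨0, hk⟩⟩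
    obtain ⟨u, hu⟩ := exists_ne (0 : Fin k → K)
    exact ⟨⟨u, hu⟩, fun _ => Classical.arbitrary α⟩
  · rw [Nat.card_prod, Nat.card_fun, Nat.card_eq_fintype_card, Nat.card_eq_fintype_card,
      Nat.card_eq_fintype_card, Fintype.card_fin]
    refine Nat.mul_le_mul_right _ ((Fintype.card_subtype_le _).trans (by simp))

theorem exists_isResilient_of_prime (p R L t : ℕ) [Fact p.Prime] (htR : t ≤ R)
    (h : R.choose t * 2 ^ t < 2 ^ L) :
    ∃ (β : Type) (_ : Finite β) (f : (Fin R → ZMod p) → β), IsResilient t f ∧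
      p ^ R ≤ Nat.card β * p ^ L := by
  classical
  have hp : p.Prime := Fact.out
  have htL : t ≤ L := by
    by_contra! hlt
    have h1 : 2 ^ L ≤ 2 ^ t := Nat.pow_le_pow_right two_pos hlt.le
    have h2 : 0 < R.choose t := Nat.choose_pos htR
    have h3 := Nat.le_mul_of_pos_left (2 ^ t) h2
    omega
  have hlt : R.choose t * p ^ t < p ^ L := by
    obtain ⟨d, rfl⟩ := Nat.exists_eq_add_of_le htL
    have h1 : R.choose t < 2 ^ d := by
      refine lt_of_mul_lt_mul_right (a := 2 ^ t) ?_ (Nat.zero_le _)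
      rwa [← pow_add, add_comm d t]
    rw [pow_add, mul_comm (p ^ t)]
    refine Nat.mul_lt_mul_of_pos_right (h1.trans_le (Nat.pow_le_pow_left hp.two_le d))
      (pow_pos hp.pos t)
  obtain ⟨a, ha⟩ : ∃ a : Fin R → Fin L → ZMod p, IsIndependentColumns t a := by
    by_contra! hcon
    have h1 := card_not_isIndependentColumns_mul_le (K := ZMod p) L R t
    have h2 : Nat.card {a : Fin R → Fin L → ZMod p // ¬ IsIndependentColumns t a} =
        p ^ (L * R) := by
      rw [Nat.card_congr (Equiv.subtypeUnivEquiv hcon)]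
      simp [pow_mul]
    rw [h2, ZMod.card, mul_comm] at h1
    exact absurd (le_of_mul_le_mul_right h1 (pow_pos hp.pos _)) (not_le.2 hlt)
  let φ : (Fin L → ZMod p) →+ (Fin R → ZMod p) :=
    { toFun := fun u i => codeword a u i
      map_zero' := by ext i; simp [codeword]
      map_add' := fun u v => by ext i; simp [codeword] }
  let D := φ.range
  refine ⟨(Fin R → ZMod p) ⧸ D, inferInstance, QuotientAddGroup.mk' D, ?_, ?_⟩
  · intro S hS v b
    let ψ : (Fin R → ZMod p) →+ ((Fin R → ZMod p) ⧸ D) × (S → ZMod p) :=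
      (QuotientAddGroup.mk' D).prod
        { toFun := fun x i => x i
          map_zero' := rfl
          map_add' := fun _ _ => rfl }
    have hψ : Function.Surjective ψ := by
      rintro ⟨c, w⟩
      obtain ⟨y, rfl⟩ := QuotientAddGroup.mk'_surjective D c
      obtain ⟨u, hu⟩ := ha.surjective htR S hS (fun i => w i - y i)
      refine ⟨y + φ u, Prod.ext ?_ ?_⟩
      · change QuotientAddGroup.mk' D (y + φ u) = QuotientAddGroup.mk' D y
        rw [map_add, (QuotientAddGroup.eq_zero_iff (φ u)).2 ⟨u, rfl⟩ |> fun h =>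
          (show QuotientAddGroup.mk' D (φ u) = 0 from h), add_zero]
      · ext i
        have := congrFun hu i
        change codeword a u i = w i - y i at this
        change y i + codeword a u i = w i
        rw [this, add_sub_cancel]
    have hfib := card_fiber_mul_card_of_surjective ψ hψ (b, fun i => v i)
    rw [Nat.card_prod, Nat.card_fun, Nat.card_eq_fintype_card (α := S), Fintype.card_coe] at hfib
    rw [← hfib]
    congr 1
    refine Nat.card_congr (Equiv.subtypeEquivRight fun x => ?_)
    simp [ψ, funext_iff]
  · have h1 := AddSubgroup.card_eq_card_quotient_mul_card_addSubgroup D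
    have h2 : Nat.card D ≤ p ^ L := by
      have := Nat.card_le_card_of_surjective φ.rangeRestrict φ.rangeRestrict_surjective
      rwa [Nat.card_fun, Nat.card_zmod, Nat.card_eq_fintype_card (α := Fin L),
        Fintype.card_fin] at this
    have h3 : Nat.card (Fin R → ZMod p) = p ^ R := by simp
    rw [← h3, h1]
    exact Nat.mul_le_mul_left _ h2

theorem IsResilient.comp_equiv {ι α α' β : Type} {t : ℕ} {f : (ι → α) → β}
    (hf : IsResilient t f) (e : α' ≃ α) : IsResilient t fun x : ι → α' => f (e ∘ x) := by
  intro S hS v b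
  have h := hf S hS (e ∘ v) b
  rw [Nat.card_congr e, Nat.card_congr (Equiv.arrowCongr (Equiv.refl ι) e), ← h]
  congr 1
  refine Nat.card_congr (Equiv.subtypeEquiv (Equiv.arrowCongr (Equiv.refl ι) e) fun x => ?_)
  have : (Equiv.arrowCongr (Equiv.refl ι) e) x = e ∘ x := rfl
  rw [this]
  simp

theorem IsResilient.prod {ι α₁ α₂ β₁ β₂ : Type} {t : ℕ} {f₁ : (ι → α₁) → β₁}
    {f₂ : (ι → α₂) → β₂} (h₁ : IsResilient t f₁) (h₂ : IsResilient t f₂) :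
    IsResilient t fun x : ι → α₁ × α₂ => (f₁ fun i => (x i).1, f₂ fun i => (x i).2) := by
  rintro S hS v ⟨b₁, b₂⟩
  have e₁ := h₁ S hS (fun i => (v i).1) b₁
  have e₂ := h₂ S hS (fun i => (v i).2) b₂
  let E := Equiv.arrowProdEquivProdArrow ι (fun _ => α₁) (fun _ => α₂)
  have hE : Nat.card (ι → α₁ × α₂) = Nat.card (ι → α₁) * Nat.card (ι → α₂) := by
    rw [Nat.card_congr E, Nat.card_prod]
  rw [hE, ← e₁, ← e₂, Nat.card_prod, Nat.card_prod, mul_pow, mul_mul_mul_comm _ _ _ (_ * _),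
    mul_mul_mul_comm (Nat.card β₁)]
  congr 1
  rw [← Nat.card_prod]
  refine Nat.card_congr ((Equiv.subtypeEquiv (q := fun y : (ι → α₁) × (ι → α₂) =>
    (f₁ y.1 = b₁ ∧ ∀ i ∈ S, y.1 i = (v i).1) ∧ (f₂ y.2 = b₂ ∧ ∀ i ∈ S, y.2 i = (v i).2))
    E fun x => ?_).trans (Equiv.subtypeProdEquivProd
      (p := fun y => f₁ y = b₁ ∧ ∀ i ∈ S, y i = (v i).1)
      (q := fun y => f₂ y = b₂ ∧ ∀ i ∈ S, y i = (v i).2)))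
  simp only [E, Equiv.arrowProdEquivProdArrow, Equiv.coe_fn_mk, Prod.ext_iff]
  constructor
  · rintro ⟨⟨h1, h2⟩, h3⟩
    exact ⟨⟨h1, fun i hi => (h3 i hi).1⟩, h2, fun i hi => (h3 i hi).2⟩
  · rintro ⟨⟨h1, h3⟩, h2, h4⟩
    exact ⟨⟨h1, h2⟩, fun i hi => ⟨h3 i hi, h4 i hi⟩⟩

theorem exists_isResilient (R L t q : ℕ) (htR : t ≤ R) (h : R.choose t * 2 ^ t < 2 ^ L)
    (hq : q ≠ 0) :
    ∃ (β : Type) (_ : Finite β) (f : (Fin R → Fin q) → β), IsResilient t f ∧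
      q ^ R ≤ Nat.card β * q ^ L := by
  induction q using induction_on_primes with
  | zero => exact absurd rfl hq
  | one =>
    refine ⟨Unit, inferInstance, fun _ => (), fun S _ v b => ?_, by simp⟩
    have : Unique {x : Fin R → Fin 1 // () = b ∧ ∀ i ∈ S, x i = v i} :=
      { default := ⟨v, rfl, fun _ _ => rfl⟩, uniq := fun _ => Subsingleton.elim _ _ }
    rw [Nat.card_unique]
    simp
  | prime_mul p a hp ih =>
    have : Fact p.Prime := ⟨hp⟩
    obtain ⟨β₁, _, f₁, hf₁, hc₁⟩ := exists_isResilient_of_prime p R L t htR h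
    obtain ⟨β₂, _, f₂, hf₂, hc₂⟩ := ih (right_ne_zero_of_mul hq)
    have e : Fin (p * a) ≃ ZMod p × Fin a :=
      finProdFinEquiv.symm.trans ((ZMod.finEquiv p).toEquiv.prodCongr (Equiv.refl _))
    refine ⟨β₁ × β₂, inferInstance, _, (hf₁.prod hf₂).comp_equiv e, ?_⟩
    rw [Nat.card_prod, mul_pow, mul_pow, mul_mul_mul_comm]
    exact Nat.mul_le_mul hc₁ hc₂

theorem IsUniformFamily.reindex {Ω ι κ α : Type} {t : ℕ} {X : Ω → ι → α}
    (hX : IsUniformFamily t X) (j : κ ↪ ι) : IsUniformFamily t fun ω i => X ω (j i) := by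
  classical
  intro S hS v
  rcases isEmpty_or_nonempty κ with hκ | hκ
  · have hS0 : S = ∅ := Finset.eq_empty_of_isEmpty S
    subst hS0
    simp
  have h := hX (S.map j) (by simpa using hS) (fun i => v (Function.invFun j i))
  rw [Finset.card_map] at h
  rw [← h]
  congr 1
  refine Nat.card_congr (Equiv.subtypeEquivRight fun ω => ?_)
  simp [Function.leftInverse_invFun j.injective _]

/-- The rows of a uniform family become distinct after appending, to the row of `ω`, all words
of the fiber of a resilient function over the point `e ω`. -/
theorem IsUniformFamily.append {Ω ι κ α β : Type} [Finite Ω] [Finite κ] [Finite α] [Finite β]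
    [Nonempty β] {t : ℕ} {X : Ω → ι → α} (hX : IsUniformFamily t X) {f : (κ → α) → β}
    (hf : IsResilient t f) (e : Ω → β) :
    IsUniformFamily t fun (p : {p : Ω × (κ → α) // f p.2 = e p.1}) => Sum.elim (X p.1.1) p.1.2 := by
  classical
  cases nonempty_fintype Ω
  have hβ : 0 < Nat.card β := Nat.card_pos
  have count : ∀ (S : Finset (ι ⊕ κ)), S.card ≤ t → ∀ v : ι ⊕ κ → α,
      Nat.card {p : {p : Ω × (κ → α) // f p.2 = e p.1} //
        ∀ i ∈ S, Sum.elim (X p.1.1) p.1.2 i = v i} * Nat.card α ^ S.card * Nat.card β =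
      Nat.card Ω * Nat.card (κ → α) := by
    intro S hS v
    have hcard : S.toLeft.card + S.toRight.card = S.card := Finset.card_toLeft_add_card_toRight
    have hl := hX S.toLeft (by omega) (fun i => v (Sum.inl i))
    have hr := fun ω => hf S.toRight (by omega) (fun i => v (Sum.inr i)) (e ω)
    let E : {p : {p : Ω × (κ → α) // f p.2 = e p.1} //
          ∀ i ∈ S, Sum.elim (X p.1.1) p.1.2 i = v i} ≃
        Σ ω : {ω // ∀ i ∈ S.toLeft, X ω i = v (Sum.inl i)},
          {x // f x = e ω ∧ ∀ i ∈ S.toRight, x i = v (Sum.inr i)} :=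
      { toFun := fun p => ⟨⟨p.1.1.1, fun i hi => p.2 _ (Finset.mem_toLeft.1 hi)⟩,
          ⟨p.1.1.2, p.1.2, fun i hi => p.2 _ (Finset.mem_toRight.1 hi)⟩⟩
        invFun := fun p => ⟨⟨(p.1.1, p.2.1), p.2.2.1⟩, fun i hi => by
          cases i with
          | inl i => exact p.1.2 i (Finset.mem_toLeft.2 hi)
          | inr i => exact p.2.2.2 i (Finset.mem_toRight.2 hi)⟩
        left_inv := fun _ => rfl
        right_inv := fun _ => rfl }
    rw [Nat.card_congr E, Nat.card_sigma, ← hcard, pow_add, Finset.sum_mul, Finset.sum_mul,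
      Finset.sum_congr rfl (g := fun _ => Nat.card α ^ S.toLeft.card * Nat.card (κ → α)),
      Finset.sum_const, smul_eq_mul, Finset.card_univ, ← Nat.card_eq_fintype_card, ← mul_assoc, hl]
    intro ω _
    rw [← hr ω]
    ring
  intro S hS v
  refine Nat.eq_of_mul_eq_mul_right hβ ((count S hS v).trans ?_)
  rw [← count ∅ (by simp) v]
  simp

theorem Nat.choose_le_three_mul_pow {n m y : ℕ} (h : n ≤ m * y) : n.choose m ≤ (3 * y) ^ m := by
  have hfac : (0 : ℝ) < m.factorial := by positivity
  have h1 : ((n.choose m : ℕ) : ℝ) ≤ (n : ℝ) ^ m / m.factorial := Nat.choose_le_pow_div m n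
  have h2 : (n : ℝ) ≤ m * y := by exact_mod_cast h
  have h3 : (m : ℝ) ^ m / m.factorial ≤ 3 ^ m :=
    calc (m : ℝ) ^ m / m.factorial ≤ Real.exp m := Real.pow_div_factorial_le_exp m (by positivity) m
      _ = Real.exp 1 ^ m := by rw [← Real.exp_nat_mul, mul_one]
      _ ≤ 3 ^ m := pow_le_pow_left₀ (Real.exp_pos 1).le Real.exp_one_lt_three.le m
  have h4 : ((n.choose m : ℕ) : ℝ) ≤ (3 * y) ^ m :=
    calc ((n.choose m : ℕ) : ℝ) ≤ (m * y : ℝ) ^ m / m.factorial := h1.trans (by gcongr)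
      _ = (m : ℝ) ^ m / m.factorial * y ^ m := by rw [mul_pow]; ring
      _ ≤ 3 ^ m * y ^ m := by gcongr
      _ = _ := by rw [mul_pow]
  exact_mod_cast h4

/-- A uniform family with few, possibly repeated, rows for `n ≤ t * q ^ e`. -/
theorem exists_isUniformFamily_card_le {q n t e : ℕ} (hq : 2 ≤ q) (ht : 0 < t) (htn : t ≤ n)
    (hn : n ≤ t * q ^ e) :
    ∃ (Ω : Type) (_ : Finite Ω) (_ : Nonempty Ω) (X : Ω → Fin n → Fin q), IsUniformFamily t X ∧
      Nat.card Ω ≤ q ^ (4 * t * (e + 6)) := by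
  set y := q ^ e with hy
  have hy0 : 0 < y := by positivity
  have hA0 : 64 * (q * y) ^ 2 ≠ 0 := by positivity
  set s := Nat.log 2 (64 * (q * y) ^ 2) + 1 with hs
  have hlow : 64 * (q * y) ^ 2 < 2 ^ s := Nat.lt_pow_succ_log_self one_lt_two _
  have hup : 2 ^ s ≤ 128 * (q * y) ^ 2 := by
    have := Nat.pow_log_le_self 2 hA0
    rw [hs, pow_succ]
    omega
  let : Fintype (GaloisField 2 s) := Fintype.ofFinite _
  have hK : Fintype.card (GaloisField 2 s) = 2 ^ s := by
    rw [← Nat.card_eq_fintype_card, GaloisField.card 2 s (by omega)]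
  have : Nonempty (Fin q) := ⟨⟨0, by omega⟩⟩
  set Q := 2 ^ s with hQ
  have hQ0 : 0 < Q := by positivity
  have hqy : y ≤ q * y := Nat.le_mul_of_pos_left y (by omega)
  have hqy2 : q * y ≤ (q * y) ^ 2 := Nat.le_self_pow two_ne_zero _
  obtain ⟨Ω, hΩ, hΩ', X, hX, hcard⟩ := exists_isUniformFamily (α := Fin q) (GaloisField 2 s)
    (n := n) (t := t) (m := 4 * t) (k := 2 * t) htn (by omega) (by omega) (by
      rw [hK, two_mul t, pow_add, ← mul_assoc]
      refine Nat.mul_lt_mul_of_pos_right ?_ (by positivity)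
      calc 2 * n.choose t ≤ 2 ^ t * (3 * y) ^ t :=
            Nat.mul_le_mul (Nat.le_self_pow ht.ne' 2) (Nat.choose_le_three_mul_pow hn)
        _ = (2 * (3 * y)) ^ t := (mul_pow _ _ _).symm
        _ < Q ^ t := Nat.pow_lt_pow_left (by omega) ht.ne') (by
      rw [hK, Fintype.card_fin]
      calc 2 * (Q ^ (2 * t) * n.choose (4 * t) * q ^ (4 * t))
          ≤ 2 ^ (2 * t) * (Q ^ (2 * t) * (3 * y) ^ (4 * t) * q ^ (4 * t)) := by
            gcongr
            · exact Nat.le_self_pow (by omega) 2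
            · exact Nat.choose_le_three_mul_pow (hn.trans (Nat.mul_le_mul_right _ (by omega)))
        _ = Q ^ (2 * t) * (18 * (q * y) ^ 2) ^ (2 * t) := by
            rw [show 4 * t = 2 * (2 * t) by ring, pow_mul (3 * y), pow_mul q,
              show 18 * (q * y) ^ 2 = 2 * (3 * y) ^ 2 * q ^ 2 by ring, mul_pow _ (q ^ 2),
              mul_pow 2 ((3 * y) ^ 2)]
            generalize 2 ^ (2 * t) = a, ((3 * y) ^ 2) ^ (2 * t) = b
            ring
        _ ≤ Q ^ (2 * t) * Q ^ (2 * t) := by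
            gcongr
            omega
        _ = Q ^ (4 * t) := by rw [← pow_add]; congr 1; ring)
  refine ⟨Ω, hΩ, hΩ', X, hX, hcard.trans ?_⟩
  have h128 : 128 ≤ q ^ 7 := Nat.pow_le_pow_left hq 7
  rw [hK, Fintype.card_fin]
  calc Q ^ (2 * t) * q ^ (4 * t) ≤ (q ^ 7 * (q * y) ^ 2) ^ (2 * t) * q ^ (4 * t) := by
        gcongr
        exact hup.trans (Nat.mul_le_mul_right _ h128)
    _ = q ^ ((7 + 2 * (1 + e)) * (2 * t) + 4 * t) := by
        rw [hy, ← pow_succ', ← pow_mul, ← pow_add, ← pow_mul, ← pow_add]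
        congr 3; ring
    _ ≤ q ^ (4 * t * (e + 6)) := Nat.pow_le_pow_right (by omega) (by nlinarith)

theorem IsUniformFamily.isOrthogonalArray {Ω : Type} [Fintype Ω] {q n t : ℕ} [Nonempty (Fin q)]
    {X : Ω → Fin n → Fin q} (hX : IsUniformFamily t X) (hinj : Function.Injective X) :
    IsOrthogonalArray q n t (Finset.univ.map ⟨X, hinj⟩) := by
  classical
  intro idx hidx val
  have h := hX (Finset.univ.map ⟨idx, hidx⟩) (by simp)
    (Function.extend idx val fun _ => Classical.arbitrary _)
  simp only [Finset.mem_map, Finset.mem_univ, true_and, Function.Embedding.coeFn_mk,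
    forall_exists_index, forall_apply_eq_imp_iff, hidx.extend_apply, Finset.card_map,
    Finset.card_univ, Fintype.card_fin, Nat.card_eq_fintype_card, Fintype.card_subtype] at h
  rw [Finset.filter_map, Finset.card_map, Finset.card_map, Finset.card_univ, ← h]
  rfl

theorem isOrthogonalArray_univ {q n t : ℕ} [Nonempty (Fin q)] :
    IsOrthogonalArray q n t Finset.univ := by
  have h : IsUniformFamily t fun x : Fin n → Fin q => x := fun S _ v => by
    have := card_agree_on_injOn_mul S id (Set.injOn_id _) v
    rwa [Nat.card_fun, Nat.card_eq_fintype_card (α := Fin n), Fintype.card_fin]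
  have := h.isOrthogonalArray Function.injective_id
  rwa [show Finset.univ.map ⟨fun x : Fin n → Fin q => x, Function.injective_id⟩ = Finset.univ from
    Finset.map_refl] at this

theorem exists_isOrthogonalArray_card_le {q n t e : ℕ} (hq : 2 ≤ q) (ht : 0 < t)
    (hn : n ≤ t * q ^ e) (hR : t * (8 * (e + 6)) ≤ n) :
    ∃ T : Finset (Fin n → Fin q), T.Nonempty ∧ IsOrthogonalArray q n t T ∧
      T.card ≤ q ^ (t * (8 * (e + 6))) := by
  classical
  have : Nonempty (Fin q) := ⟨⟨0, by omega⟩⟩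
  obtain ⟨R, hRdef⟩ : ∃ R, R = t * (8 * (e + 6)) := ⟨_, rfl⟩
  rw [← hRdef] at hR ⊢
  have htR : t ≤ R := hRdef ▸ Nat.le_mul_of_pos_right t (by omega)
  obtain ⟨Ω, _, _, X, hX, hΩ⟩ := exists_isUniformFamily_card_le hq ht (htR.trans hR) hn
  have hchoose : R.choose t * 2 ^ t < 2 ^ (4 * t * (e + 6)) := by
    have hz : e + 6 < 2 ^ (e + 6) := Nat.lt_two_pow_self
    have h8 : 48 ≤ 8 ^ (e + 6) :=
      calc 48 ≤ 8 ^ 6 := by norm_num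
        _ ≤ 8 ^ (e + 6) := Nat.pow_le_pow_right (by norm_num) (Nat.le_add_left 6 e)
    calc R.choose t * 2 ^ t ≤ (3 * (8 * (e + 6))) ^ t * 2 ^ t :=
          Nat.mul_le_mul_right _ (Nat.choose_le_three_mul_pow hRdef.le)
      _ = (48 * (e + 6)) ^ t := by
          rw [← mul_pow, show 3 * (8 * (e + 6)) * 2 = 48 * (e + 6) by ring]
      _ < (8 ^ (e + 6) * 2 ^ (e + 6)) ^ t := by
          refine Nat.pow_lt_pow_left ?_ ht.ne'
          exact Nat.mul_lt_mul_of_le_of_lt h8 hz (by norm_num)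
      _ = 2 ^ (4 * t * (e + 6)) := by
          rw [← mul_pow, show 8 * 2 = 2 ^ 4 by norm_num, ← pow_mul, ← pow_mul]
          congr 1; ring
  obtain ⟨β, _, f, hf, hβ⟩ := exists_isResilient R (4 * t * (e + 6)) t q htR hchoose (by omega)
  have hβΩ : Nat.card Ω ≤ Nat.card β := by
    refine hΩ.trans (le_of_mul_le_mul_right (a := q ^ (4 * t * (e + 6))) ?_ (by positivity))
    rw [← pow_add]
    refine le_trans (le_of_eq ?_) hβ
    congr 1; rw [hRdef]; ring
  cases nonempty_fintype Ω
  cases nonempty_fintype β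
  rw [Nat.card_eq_fintype_card, Nat.card_eq_fintype_card] at hβΩ
  obtain ⟨g⟩ := Function.Embedding.nonempty_of_card_le hβΩ
  have : Nonempty β := ⟨g (Classical.arbitrary Ω)⟩
  let σ : Fin n ≃ Fin (n - R) ⊕ Fin R :=
    (finCongr (Nat.sub_add_cancel hR).symm).trans finSumFinEquiv.symm
  have hY := ((hX.reindex (Fin.castLEEmb (Nat.sub_le n R))).append hf g).reindex σ.toEmbedding
  let : Fintype {p : Ω × (Fin R → Fin q) // f p.2 = g p.1} := Fintype.ofFinite _
  have hinj₂ : Function.Injective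
      fun p : {p : Ω × (Fin R → Fin q) // f p.2 = g p.1} => p.1.2 := by
    rintro ⟨⟨ω, x⟩, hp⟩ ⟨⟨ω', x'⟩, hp'⟩ (rfl : x = x')
    have : ω = ω' := g.injective (hp.symm.trans hp')
    subst this
    rfl
  refine ⟨_, ?_, hY.isOrthogonalArray ?_, ?_⟩
  · rw [Finset.map_nonempty, Finset.univ_nonempty_iff]
    have h0 := hf ∅ (by simp) (fun _ => ⟨0, by omega⟩) (g (Classical.arbitrary Ω))
    have hpos : 0 < Nat.card (Fin R → Fin q) := Nat.card_pos
    rw [← h0] at hpos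
    have := (Nat.card_pos_iff.1 (Nat.pos_of_mul_pos_right hpos)).1
    obtain ⟨x, hx⟩ := this
    exact ⟨⟨(_, x), hx.1⟩⟩
  · intro p p' h
    refine hinj₂ (funext fun i => ?_)
    simpa using congrFun h (σ.symm (Sum.inr i))
  · rw [Finset.card_map, Finset.card_univ]
    refine (Fintype.card_le_of_injective _ hinj₂).trans (by simp)

/-- There exists a universal constant `c > 0` such that for all integers `q ≥ 2`, `n ≥ 1`
and `1 ≤ t ≤ n` there exists a (nonempty) orthogonal array `T` of alphabet size `q`, length
`n` and strength `t` satisfying `|T| ≤ (c·q·n/t)^(c·t)`. -/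
theorem exists_orthogonal_array :
    ∃ c : ℝ, 0 < c ∧
      ∀ q n t : ℕ, 2 ≤ q → 1 ≤ n → 1 ≤ t → t ≤ n →
        ∃ T : Finset (Fin n → Fin q), T.Nonempty ∧ IsOrthogonalArray q n t T ∧
          (T.card : ℝ) ≤ (c * q * n / t) ^ (c * t) := by
  refine ⟨256, by norm_num, fun q n t hq hn ht htn => ?_⟩
  have ht0 : (0 : ℝ) < t := by exact_mod_cast ht
  have hq1 : (1 : ℝ) ≤ q := by exact_mod_cast (by omega : 1 ≤ q)
  have hx : (1 : ℝ) ≤ n / t := (one_le_div ht0).2 (by exact_mod_cast htn)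
  have hqx : (1 : ℝ) ≤ q * (n / t) := one_le_mul_of_one_le_of_one_le hq1 hx
  have hbase : (256 * q * n / t : ℝ) = 256 * (q * (n / t)) := by ring
  have hexp : (256 * t : ℝ) = ((256 * t : ℕ) : ℝ) := by push_cast; rfl
  have hle : (q * (n / t) : ℝ) ≤ 256 * (q * (n / t)) := by linarith
  rw [hbase, hexp, Real.rpow_natCast]
  by_cases hsmall : n < 128 * t
  · have : Nonempty (Fin q) := ⟨⟨0, by omega⟩⟩
    refine ⟨Finset.univ, Finset.univ_nonempty, isOrthogonalArray_univ, ?_⟩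
    simp only [Finset.card_univ, Fintype.card_pi, Fintype.card_fin, Finset.prod_const,
      Nat.cast_pow]
    calc (q : ℝ) ^ n ≤ q ^ (256 * t) := pow_le_pow_right₀ hq1 (by omega)
      _ ≤ _ := by
        gcongr
        nlinarith
  · have hex : ∃ e, n ≤ t * q ^ e := ⟨n, (Nat.lt_pow_self (by omega : 1 < q)).le.trans
      (Nat.le_mul_of_pos_left _ ht)⟩
    obtain ⟨e, he, hmin⟩ : ∃ e, n ≤ t * q ^ (e + 1) ∧ t * q ^ e < n := by
      have hne : Nat.find hex ≠ 0 := by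
        intro h0
        have := Nat.find_spec hex
        rw [h0, pow_zero] at this
        omega
      obtain ⟨e, he⟩ := Nat.exists_eq_succ_of_ne_zero hne
      have hspec := Nat.find_spec hex
      rw [he] at hspec
      exact ⟨e, hspec, not_le.1 (Nat.find_min hex (by omega))⟩
    have hR : t * (8 * (e + 1 + 6)) ≤ n := by
      rcases Nat.lt_or_ge e 10 with h | h
      · have : t * (8 * (e + 1 + 6)) ≤ t * 128 := Nat.mul_le_mul_left _ (by omega)
        omega
      · have h2 : 8 * (e + 1 + 6) ≤ 2 ^ e := by
          clear he hmin
          induction e, h using Nat.le_induction with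
          | base => norm_num
          | succ d _ ih => rw [pow_succ]; omega
        exact (Nat.mul_le_mul_left t (h2.trans (Nat.pow_le_pow_left hq e))).trans hmin.le
    obtain ⟨T, hT, hOA, hcard⟩ := exists_isOrthogonalArray_card_le hq ht he hR
    refine ⟨T, hT, hOA, ?_⟩
    have hqe : (q : ℝ) ^ e ≤ n / t := by
      rw [le_div_iff₀ ht0, mul_comm]
      exact_mod_cast hmin.le
    calc (T.card : ℝ) ≤ (q : ℝ) ^ (t * (8 * (e + 1 + 6))) := by exact_mod_cast hcard
      _ = (q ^ 7 * q ^ e) ^ (8 * t) := by rw [← pow_add, ← pow_mul]; congr 1; ring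
      _ ≤ (q ^ 7 * (n / t) ^ 7) ^ (8 * t) := by
          gcongr
          exact hqe.trans (le_self_pow₀ hx (by norm_num))
      _ = (q * (n / t)) ^ (56 * t) := by rw [← mul_pow, ← pow_mul]; congr 1; ring
      _ ≤ (q * (n / t)) ^ (256 * t) := pow_le_pow_right₀ hqx (by omega)
      _ ≤ _ := by gcongr
end

section
/- There exists a constant c > 0 such that for all integers q ≥ 2, n ≥ 1 and 1 ≤ t ≤ n and for all N such that N is a multiple of q^t and min(N, q^n − N) ≥ (c·q·n/t)^(c·t), the number of orthogonal arrays T of alphabet size q, length n, strength t with |T| = N equals [ q^(−(1/2)·n·C(n−1,t)·(q−1)^t) / ( (2π·p·(1−p))^((1/2)·Σ_{i=0}^{t} C(n,i)(q−1)^i) · p^N · (1−p)^(q^n−N) ) ] · (1+δ), where p := N/q^n and |δ| ≤ (c·q·n/t)^(c·t) / √(min(N, q^n − N)). -/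
namespace OrthArray

open MeasureTheory

/-- The characteristic function, at frequency `2 * π * s`, of a centred Bernoulli variable with
success probability `p`. -/
noncomputable def bernoulliChar (p s : ℝ) : ℂ :=
  (1 - p) * Complex.exp ((2 * Real.pi * (-(p * s)) : ℝ) * Complex.I)
    + p * Complex.exp ((2 * Real.pi * ((1 - p) * s) : ℝ) * Complex.I)

lemma continuous_bernoulliChar (p : ℝ) : Continuous (bernoulliChar p) := by
  unfold bernoulliChar
  fun_prop

lemma eight_mul_dist_round_sq_le (s : ℝ) :
    8 * (s - round s) ^ 2 ≤ 1 - Real.cos (2 * Real.pi * s) := by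
  have hpi := Real.pi_pos
  have h1 : Real.cos (2 * Real.pi * s) = Real.cos (2 * Real.pi * (s - round s)) := by
    rw [← Real.cos_sub_int_mul_two_pi _ (round s)]
    congr 1; ring
  have h2 : |2 * Real.pi * (s - round s)| ≤ Real.pi := by
    rw [abs_mul, abs_of_pos (by positivity : 0 < 2 * Real.pi)]
    have := abs_sub_round s
    nlinarith
  have h3 := Real.cos_le_one_sub_mul_cos_sq h2
  rw [h1]
  have h4 : 2 / Real.pi ^ 2 * (2 * Real.pi * (s - round s)) ^ 2 = 8 * (s - round s) ^ 2 := by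
    field_simp; ring
  linarith

lemma norm_bernoulliChar_sq (p s : ℝ) :
    ‖bernoulliChar p s‖ ^ 2 = 1 - 2 * (p * (1 - p)) * (1 - Real.cos (2 * Real.pi * s)) := by
  have hcos : Real.cos (2 * Real.pi * s) =
      Real.cos (2 * Real.pi * ((1 - p) * s)) * Real.cos (2 * Real.pi * (-(p * s))) +
      Real.sin (2 * Real.pi * ((1 - p) * s)) * Real.sin (2 * Real.pi * (-(p * s))) := by
    rw [← Real.cos_sub]; congr 1; ring
  have ha := Real.sin_sq_add_cos_sq (2 * Real.pi * ((1 - p) * s))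
  have hb := Real.sin_sq_add_cos_sq (2 * Real.pi * (-(p * s)))
  rw [hcos, Complex.sq_norm, Complex.normSq_apply, bernoulliChar]
  simp only [Complex.add_re, Complex.add_im, Complex.mul_re, Complex.mul_im,
    Complex.exp_ofReal_mul_I_re, Complex.exp_ofReal_mul_I_im, Complex.sub_re, Complex.sub_im,
    Complex.one_re, Complex.one_im, Complex.ofReal_re, Complex.ofReal_im]
  linear_combination p ^ 2 * ha + (1 - p) ^ 2 * hb

lemma norm_bernoulliChar_le {p : ℝ} (s : ℝ) (hp0 : 0 ≤ p) (hp1 : p ≤ 1) :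
    ‖bernoulliChar p s‖ ≤ Real.exp (-(8 * (p * (1 - p)) * (s - round s) ^ 2)) := by
  have hv : 0 ≤ p * (1 - p) := mul_nonneg hp0 (by linarith)
  have h := eight_mul_dist_round_sq_le s
  refine le_of_sq_le_sq ?_ (Real.exp_nonneg _)
  rw [norm_bernoulliChar_sq, ← Real.exp_nat_mul]
  refine le_trans ?_ (Real.add_one_le_exp _)
  push_cast
  nlinarith

lemma norm_bernoulliChar_sub_le {p s : ℝ} (hp0 : 0 ≤ p) (hp1 : p ≤ 1)
    (hs : 2 * Real.pi * |s| ≤ 1) :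
    ‖bernoulliChar p s - Real.exp (-(2 * Real.pi ^ 2 * (p * (1 - p)) * s ^ 2))‖
      ≤ p * (1 - p) * (2 * Real.pi * |s|) ^ 3 / 2 := by
  have hpi := Real.pi_pos
  set a : ℝ := 2 * Real.pi * s with ha
  have habs : |a| = 2 * Real.pi * |s| := by
    rw [ha, abs_mul, abs_of_pos (by positivity : 0 < 2 * Real.pi)]
  set v := p * (1 - p) with hv
  have hv0 : 0 ≤ v := mul_nonneg hp0 (by linarith)
  have hv4 : v ≤ 1 / 4 := by rw [hv]; nlinarith [sq_nonneg (p - 1 / 2)]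
  have key : ∀ y : ℝ, |y| ≤ 1 →
      ‖Complex.exp ((y : ℝ) * Complex.I) - (1 + y * Complex.I - y ^ 2 / 2)‖
        ≤ |y| ^ 3 * (2 / 9) := by
    intro y hy
    have h := Complex.exp_bound (x := (y : ℂ) * Complex.I) (by simpa using hy)
      (n := 3) (by norm_num)
    simp only [norm_mul, Complex.norm_I, mul_one, Complex.norm_real, Real.norm_eq_abs] at h
    convert h using 2
    · congr 1
      simp only [Finset.sum_range_succ, Finset.range_zero, Finset.sum_empty, Nat.factorial]
      ring_nf
      simp only [Complex.I_sq]
      ring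
    · simp [Nat.factorial]; norm_num
  have ha1 : |a| ≤ 1 := habs ▸ hs
  have hA := abs_nonneg a
  have y1 : |-(p * a)| = p * |a| := by rw [abs_neg, abs_mul, abs_of_nonneg hp0]
  have y2 : |(1 - p) * a| = (1 - p) * |a| := by
    rw [abs_mul, abs_of_nonneg (by linarith : 0 ≤ 1 - p)]
  have k1 := key (-(p * a)) (by rw [y1]; nlinarith)
  have k2 := key ((1 - p) * a) (by rw [y2]; nlinarith)
  rw [y1] at k1
  rw [y2] at k2
  have hz0 : 0 ≤ v * a ^ 2 / 2 := by positivity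
  have hz1 : |-(v * a ^ 2 / 2)| ≤ 1 := by
    rw [abs_neg, abs_of_nonneg hz0, ← sq_abs]
    nlinarith [mul_le_mul ha1 ha1 hA zero_le_one]
  have k3 := Real.abs_exp_sub_one_sub_id_le hz1
  have hg : -(2 * Real.pi ^ 2 * v * s ^ 2) = -(v * a ^ 2 / 2) := by rw [ha]; ring
  rw [hg, ← habs]
  have e1 : 2 * Real.pi * (-(p * s)) = -(p * a) := by rw [ha]; ring
  have e2 : 2 * Real.pi * ((1 - p) * s) = (1 - p) * a := by rw [ha]; ring
  have hdecomp : bernoulliChar p s - (Real.exp (-(v * a ^ 2 / 2)) : ℝ) =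
      (1 - p : ℝ) * (Complex.exp ((-(p * a) : ℝ) * Complex.I)
        - (1 + (-(p * a) : ℝ) * Complex.I - (-(p * a) : ℝ) ^ 2 / 2))
      + (p : ℝ) * (Complex.exp (((1 - p) * a : ℝ) * Complex.I)
        - (1 + ((1 - p) * a : ℝ) * Complex.I - ((1 - p) * a : ℝ) ^ 2 / 2))
      - ((Real.exp (-(v * a ^ 2 / 2)) - 1 - (-(v * a ^ 2 / 2)) : ℝ) : ℂ) := by
    rw [bernoulliChar, e1, e2, hv]
    push_cast
    ring
  rw [hdecomp]
  refine (norm_sub_le _ _).trans ?_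
  refine (add_le_add_left (norm_add_le _ _) _).trans ?_
  rw [norm_mul, norm_mul, Complex.norm_real, Complex.norm_real, Complex.norm_real,
    Real.norm_of_nonneg hp0, Real.norm_of_nonneg (by linarith : 0 ≤ 1 - p), Real.norm_eq_abs]
  have m1 := mul_le_mul_of_nonneg_left k1 (by linarith : 0 ≤ 1 - p)
  have m2 := mul_le_mul_of_nonneg_left k2 hp0
  have m3 : (1 - p) * ((p * |a|) ^ 3 * (2 / 9)) + p * (((1 - p) * |a|) ^ 3 * (2 / 9))
      ≤ v * |a| ^ 3 * (2 / 9) := by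
    have : (1 - p) * ((p * |a|) ^ 3 * (2 / 9)) + p * (((1 - p) * |a|) ^ 3 * (2 / 9))
      = v * |a| ^ 3 * (2 / 9) * (1 - 2 * v) := by rw [hv]; ring
    rw [this]
    have : 0 ≤ v * |a| ^ 3 * (2 / 9) := by positivity
    nlinarith
  have m4 : (-(v * a ^ 2 / 2)) ^ 2 ≤ v * |a| ^ 3 * (1 / 16) := by
    have h4 : (-(v * a ^ 2 / 2)) ^ 2 = (v * |a| ^ 3) * (v * |a|) / 4 := by
      rw [← sq_abs a]; ring
    rw [h4]
    have : 0 ≤ v * |a| ^ 3 := by positivity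
    have : v * |a| ≤ 1 / 4 := by nlinarith
    nlinarith
  have : 0 ≤ v * |a| ^ 3 := by positivity
  linarith

lemma norm_bernoulliChar_div_sub_one_le {p s : ℝ} (hp0 : 0 ≤ p) (hp1 : p ≤ 1)
    (hs : 2 * Real.pi * |s| ≤ 1) :
    ‖bernoulliChar p s / Real.exp (-(2 * Real.pi ^ 2 * (p * (1 - p)) * s ^ 2)) - 1‖
      ≤ p * (1 - p) * (2 * Real.pi * |s|) ^ 3 := by
  have hpi := Real.pi_pos
  set v := p * (1 - p) with hv
  have hv0 : 0 ≤ v := mul_nonneg hp0 (by linarith)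
  have hv4 : v ≤ 1 / 4 := by rw [hv]; nlinarith [sq_nonneg (p - 1 / 2)]
  set g := Real.exp (-(2 * Real.pi ^ 2 * v * s ^ 2)) with hg
  have hgpos : 0 < g := Real.exp_pos _
  have hg2 : 1 / 2 ≤ g := by
    have h1 : 2 * Real.pi ^ 2 * v * s ^ 2 ≤ 1 / 2 := by
      have : (2 * Real.pi * |s|) ^ 2 ≤ 1 := by
        have : 0 ≤ 2 * Real.pi * |s| := by positivity
        nlinarith
      have e : 2 * Real.pi ^ 2 * v * s ^ 2 = v * (2 * Real.pi * |s|) ^ 2 / 2 := by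
        rw [← sq_abs s]; ring
      rw [e]; nlinarith
    have := Real.add_one_le_exp (-(2 * Real.pi ^ 2 * v * s ^ 2))
    linarith
  have hgc : (g : ℂ) ≠ 0 := by exact_mod_cast hgpos.ne'
  have h := norm_bernoulliChar_sub_le hp0 hp1 hs
  have e : bernoulliChar p s / g - 1 = (bernoulliChar p s - g) / g := by field_simp
  rw [e, norm_div, Complex.norm_real, Real.norm_of_nonneg hgpos.le, div_le_iff₀ hgpos]
  have : 0 ≤ v * (2 * Real.pi * |s|) ^ 3 := by positivity
  nlinarith

/-- The real function `∑ u, θ u * φ u` attached to a family `φ` of functions and coefficients. -/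
def combo {U B : Type*} [Fintype U] (φ : U → B → ℝ) (θ : U → ℝ) (x : B) : ℝ :=
  ∑ u, θ u * φ u x

/-- The unit cube centred at the origin. -/
def cube (U : Type*) : Set (U → ℝ) := Set.univ.pi fun _ => Set.Ioc (-(1 / 2)) (1 / 2)

/-- The characteristic function of the sum of independent centred Bernoulli variables weighted
by the values of `φ`. -/
noncomputable def charFn {U B : Type*} [Fintype U] [Fintype B] (φ : U → B → ℝ) (p : ℝ)
    (θ : U → ℝ) : ℂ :=
  ∏ x, bernoulliChar p (combo φ θ x)

lemma continuous_combo {U B : Type*} [Fintype U] (φ : U → B → ℝ) (x : B) :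
    Continuous fun θ => combo φ θ x := by
  unfold combo
  fun_prop

lemma continuous_charFn {U B : Type*} [Fintype U] [Fintype B] (φ : U → B → ℝ) (p : ℝ) :
    Continuous (charFn φ p) :=
  continuous_finsetProd _ fun x _ => (continuous_bernoulliChar p).comp (continuous_combo φ x)

lemma volume_cube (U : Type*) [Fintype U] : volume (cube U) = 1 := by
  rw [cube, volume_pi_pi]
  norm_num [Real.volume_Ioc]

lemma integral_Ioc_exp_int (k : ℤ) :
    ∫ s in Set.Ioc (-(1 / 2) : ℝ) (1 / 2), Complex.exp ((2 * Real.pi * k * s : ℝ) * Complex.I)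
      = if k = 0 then 1 else 0 := by
  rw [← intervalIntegral.integral_of_le (by norm_num)]
  split_ifs with hk
  · subst hk
    norm_num
  · have hc : (2 * Real.pi * k * Complex.I : ℂ) ≠ 0 := by
      simp [Real.pi_ne_zero, hk]
    have := integral_exp_mul_complex (a := -(1 / 2)) (b := 1 / 2) hc
    have e : ∀ s : ℝ, ((2 * Real.pi * k * s : ℝ) : ℂ) * Complex.I
        = (2 * Real.pi * k * Complex.I : ℂ) * s := by
      intro s; push_cast; ring
    simp only [e]
    rw [this, div_eq_zero_iff, sub_eq_zero]
    left
    rw [Complex.exp_eq_exp_iff_exists_int]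
    refine ⟨k, ?_⟩
    push_cast; ring

lemma integral_cube_exp_int {U : Type*} [Fintype U] (k : U → ℤ) :
    ∫ θ in cube U, Complex.exp ((2 * Real.pi * ∑ u, k u * θ u : ℝ) * Complex.I)
      = if k = 0 then 1 else 0 := by
  classical
  have e : ∀ θ : U → ℝ, Complex.exp ((2 * Real.pi * ∑ u, k u * θ u : ℝ) * Complex.I)
      = ∏ u, Complex.exp ((2 * Real.pi * k u * θ u : ℝ) * Complex.I) := by
    intro θ
    rw [← Complex.exp_sum, ← Finset.sum_mul]
    congr 2
    push_cast
    rw [Finset.mul_sum]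
    exact Finset.sum_congr rfl fun u _ => by ring
  simp only [e]
  rw [cube, volume_pi, Measure.restrict_pi_pi,
    integral_fintype_prod_eq_prod
      (fun u s => Complex.exp ((2 * Real.pi * k u * s : ℝ) * Complex.I))]
  simp only [integral_Ioc_exp_int]
  rw [Finset.prod_ite_zero]
  simp [funext_iff]

lemma charFn_eq_sum {U B : Type*} [Fintype U] [Fintype B] [DecidableEq B] (φ : U → B → ℝ)
    (p : ℝ) (θ : U → ℝ) :
    charFn φ p θ = ∑ T : Finset B, ((p ^ T.card * (1 - p) ^ Tᶜ.card : ℝ) : ℂ) *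
      Complex.exp ((2 * Real.pi * ∑ u, (∑ x ∈ T, φ u x - p * ∑ x, φ u x) * θ u : ℝ)
        * Complex.I) := by
  have h : ∀ x, bernoulliChar p (combo φ θ x) =
      p * Complex.exp ((2 * Real.pi * ((1 - p) * combo φ θ x) : ℝ) * Complex.I)
      + (1 - p) * Complex.exp ((2 * Real.pi * (-(p * combo φ θ x)) : ℝ) * Complex.I) :=
    fun x => add_comm _ _
  rw [charFn]
  simp only [h]
  rw [Fintype.prod_add]
  refine Finset.sum_congr rfl fun T _ => ?_
  rw [Finset.prod_mul_distrib, Finset.prod_mul_distrib, Finset.prod_const, Finset.prod_const,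
    ← Complex.exp_sum, ← Complex.exp_sum, ← Finset.sum_mul, ← Finset.sum_mul,
    mul_mul_mul_comm, ← Complex.exp_add, ← add_mul, ← Complex.ofReal_sum, ← Complex.ofReal_sum,
    ← Complex.ofReal_add]
  have hT : ∑ x ∈ Tᶜ, (combo φ θ x) = ∑ x, combo φ θ x - ∑ x ∈ T, combo φ θ x := by
    rw [← Finset.sum_add_sum_compl T]; ring
  have hS : ∀ S : Finset B, ∑ x ∈ S, combo φ θ x = ∑ u, (∑ x ∈ S, φ u x) * θ u := by
    intro S
    simp only [combo]
    rw [Finset.sum_comm]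
    exact Finset.sum_congr rfl fun u _ => by rw [Finset.sum_mul]; simp only [mul_comm]
  have h1 : ∑ x ∈ T, 2 * Real.pi * ((1 - p) * combo φ θ x)
        + ∑ x ∈ Tᶜ, 2 * Real.pi * (-(p * combo φ θ x))
      = 2 * Real.pi * ∑ u, (∑ x ∈ T, φ u x - p * ∑ x, φ u x) * θ u := by
    simp only [← Finset.mul_sum, Finset.sum_neg_distrib]
    rw [hT, ← mul_add]
    congr 1
    have h2 : (1 - p) * ∑ x ∈ T, combo φ θ x
        + -(p * (∑ x, combo φ θ x - ∑ x ∈ T, combo φ θ x))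
        = ∑ x ∈ T, combo φ θ x - p * ∑ x, combo φ θ x := by ring
    rw [h2, hS, hS, Finset.mul_sum, ← Finset.sum_sub_distrib]
    exact Finset.sum_congr rfl fun u _ => by ring
  rw [h1]
  push_cast
  rfl

/-- Fourier inversion: the integral of the characteristic function over the cube is the
probability that the random weighted sum equals its mean, provided the mean is integral. -/
theorem integral_charFn {U B : Type*} [Fintype U] [Fintype B] [DecidableEq B] (φ : U → B → ℝ)
    (p : ℝ) (φ' : U → B → ℤ) (hφ : ∀ u x, φ u x = φ' u x) (b : U → ℤ)
    (hb : ∀ u, p * ∑ x, φ u x = b u) [DecidablePred fun T : Finset B => ∀ u,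
      ∑ x ∈ T, φ u x = p * ∑ x, φ u x] :
    ∫ θ in cube U, charFn φ p θ =
      ((∑ T : Finset B with ∀ u, ∑ x ∈ T, φ u x = p * ∑ x, φ u x,
        p ^ T.card * (1 - p) ^ Tᶜ.card : ℝ) : ℂ) := by
  classical
  have e : ∀ T : Finset B, ∀ u, ∑ x ∈ T, φ u x - p * ∑ x, φ u x
      = ((∑ x ∈ T, φ' u x - b u : ℤ) : ℝ) := by
    intro T u
    rw [hb]
    push_cast
    simp only [hφ]
  simp only [charFn_eq_sum]
  rw [integral_finsetSum]
  · rw [Finset.sum_filter, Complex.ofReal_sum]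
    refine Finset.sum_congr rfl fun T _ => ?_
    rw [integral_const_mul]
    simp only [e]
    rw [integral_cube_exp_int fun u => ∑ x ∈ T, φ' u x - b u]
    have : (∀ u, ∑ x ∈ T, φ u x = p * ∑ x, φ u x) ↔
        (fun u => ∑ x ∈ T, φ' u x - b u) = 0 := by
      rw [funext_iff]
      refine forall_congr' fun u => ?_
      rw [← sub_eq_zero, e]
      simp only [Pi.zero_apply]
      exact_mod_cast Iff.rfl
    simp only [this]
    split_ifs <;> simp
  · intro T _
    refine Integrable.const_mul ?_ _
    have : IsFiniteMeasure (volume.restrict (cube U)) :=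
      ⟨by rw [Measure.restrict_apply_univ, volume_cube]; exact ENNReal.one_lt_top⟩
    refine Integrable.of_bound (C := 1) ?_ (Filter.Eventually.of_forall fun θ => ?_)
    · refine Continuous.aestronglyMeasurable ?_
      fun_prop
    · rw [Complex.norm_exp_ofReal_mul_I]

/-- The Gaussian density approximating `charFn`, with variance parameter `v`. -/
noncomputable def gaussFn {U B : Type*} [Fintype U] [Fintype B] (φ : U → B → ℝ) (v : ℝ)
    (θ : U → ℝ) : ℝ :=
  Real.exp (-(2 * Real.pi ^ 2 * v * ∑ x, combo φ θ x ^ 2))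

theorem integral_gaussFn {U B : Type*} [Fintype U] [DecidableEq U] [Fintype B] (φ : U → B → ℝ)
    (M : Matrix U U ℝ) (hM : M.det = 1) (w : U → ℝ) (hw : ∀ u, 0 < w u)
    (hq : ∀ η, ∑ x, combo φ (M.mulVec η) x ^ 2 = ∑ u, w u * η u ^ 2) {v : ℝ} (hv : 0 < v) :
    Integrable (gaussFn φ v) ∧
      ∫ θ, gaussFn φ v θ = (2 * Real.pi * v) ^ (-(Fintype.card U : ℝ) / 2) *
        (∏ u, w u) ^ (-(1 / 2) : ℝ) := by
  have hpi := Real.pi_pos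
  have hmp : MeasurePreserving (Matrix.toLin' M) volume volume := by
    refine ⟨(LinearMap.continuous_of_finiteDimensional _).measurable, ?_⟩
    rw [Real.map_matrix_volume_pi_eq_smul_volume_pi (by rw [hM]; exact one_ne_zero), hM]
    simp
  have hemb : MeasurableEmbedding (Matrix.toLin' M) := by
    refine Continuous.measurableEmbedding (LinearMap.continuous_of_finiteDimensional _) ?_
    have hu : IsUnit M := (Matrix.isUnit_iff_isUnit_det M).2 (by rw [hM]; exact isUnit_one)
    exact Matrix.mulVec_injective_iff_isUnit.2 hu
  have hcomp : ∀ η, gaussFn φ v (Matrix.toLin' M η)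
      = ∏ u, Real.exp (-(2 * Real.pi ^ 2 * v * w u) * η u ^ 2) := by
    intro η
    rw [gaussFn, Matrix.toLin'_apply, hq, ← Real.exp_sum, Finset.mul_sum,
      ← Finset.sum_neg_distrib]
    congr 1
    exact Finset.sum_congr rfl fun u _ => by ring
  constructor
  · rw [← hmp.integrable_comp_emb hemb]
    have : (gaussFn φ v ∘ Matrix.toLin' M)
        = fun η : U → ℝ => ∏ u, Real.exp (-(2 * Real.pi ^ 2 * v * w u) * η u ^ 2) :=
      funext hcomp
    rw [this]
    exact Integrable.fintype_prod (f := fun u s => Real.exp (-(2 * Real.pi ^ 2 * v * w u) * s ^ 2))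
      fun u => integrable_exp_neg_mul_sq (by have := hw u; positivity)
  · rw [← hmp.integral_comp hemb]
    simp only [hcomp]
    rw [integral_fintype_prod_volume_eq_prod
      fun u s => Real.exp (-(2 * Real.pi ^ 2 * v * w u) * s ^ 2)]
    have h1 : ∀ u, ∫ s : ℝ, Real.exp (-(2 * Real.pi ^ 2 * v * w u) * s ^ 2)
        = (2 * Real.pi * v) ^ (-(1 / 2) : ℝ) * (w u) ^ (-(1 / 2) : ℝ) := by
      intro u
      have := hw u
      have e : Real.pi / (2 * Real.pi ^ 2 * v * w u) = (2 * Real.pi * v * w u)⁻¹ := by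
        field_simp
      rw [integral_gaussian, e, Real.sqrt_inv, Real.sqrt_eq_rpow,
        ← Real.rpow_neg (by positivity), Real.mul_rpow (by positivity) this.le]
    simp only [h1]
    rw [Finset.prod_mul_distrib, Finset.prod_const, Finset.card_univ,
      Real.finsetProd_rpow _ _ fun u _ => (hw u).le, ← Real.rpow_mul_natCast (by positivity)]
    congr 2
    ring

lemma abs_combo_le {U B : Type*} [Fintype U] {φ : U → B → ℝ} (hφ : ∀ u x, |φ u x| ≤ 1)
    (θ : U → ℝ) (x : B) : |combo φ θ x| ≤ ∑ u, |θ u| := by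
  refine (Finset.abs_sum_le_sum_abs _ _).trans (Finset.sum_le_sum fun u _ => ?_)
  rw [abs_mul]
  exact mul_le_of_le_one_right (abs_nonneg _) (hφ u x)

lemma norm_charFn_le {U B : Type*} [Fintype U] [Fintype B] (φ : U → B → ℝ) {p : ℝ}
    (hp0 : 0 ≤ p) (hp1 : p ≤ 1) (θ : U → ℝ) :
    ‖charFn φ p θ‖
      ≤ Real.exp (-(8 * (p * (1 - p)) * ∑ x, (combo φ θ x - round (combo φ θ x)) ^ 2)) := by
  rw [charFn, norm_prod, Finset.mul_sum, ← Finset.sum_neg_distrib, Real.exp_sum]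
  exact Finset.prod_le_prod (fun _ _ => norm_nonneg _)
    fun x _ => norm_bernoulliChar_le _ hp0 hp1

lemma norm_charFn_sub_gaussFn_le {U B : Type*} [Fintype U] [Fintype B] {φ : U → B → ℝ}
    {p r : ℝ} (hp0 : 0 ≤ p) (hp1 : p ≤ 1) (hr : 2 * Real.pi * r ≤ 1) {θ : U → ℝ}
    (hθ : ∀ x, |combo φ θ x| ≤ r) :
    ‖charFn φ p θ - gaussFn φ (p * (1 - p)) θ‖
      ≤ (Real.exp (p * (1 - p) * Fintype.card B * (2 * Real.pi * r) ^ 3) - 1)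
        * gaussFn φ (p * (1 - p)) θ := by
  have hpi := Real.pi_pos
  set v := p * (1 - p) with hv
  have hv0 : 0 ≤ v := mul_nonneg hp0 (by linarith)
  set g : B → ℝ := fun x => Real.exp (-(2 * Real.pi ^ 2 * v * combo φ θ x ^ 2)) with hg
  have hgG : gaussFn φ v θ = ∏ x, g x := by
    rw [gaussFn, hg, ← Real.exp_sum, Finset.mul_sum, ← Finset.sum_neg_distrib]
  have hgne : ∀ x, ((g x : ℝ) : ℂ) ≠ 0 := fun x => by exact_mod_cast (Real.exp_pos _).ne'
  have hGpos : 0 < gaussFn φ v θ := Real.exp_pos _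
  have hfac : charFn φ p θ - gaussFn φ v θ = gaussFn φ v θ *
      (∏ x, (1 + (bernoulliChar p (combo φ θ x) / g x - 1)) - 1) := by
    rw [charFn, hgG]
    push_cast
    simp only [add_sub_cancel]
    rw [mul_sub, ← Finset.prod_mul_distrib, mul_one]
    congr 1
    exact Finset.prod_congr rfl fun x _ => by field_simp [hgne x]
  rw [hfac, norm_mul, Complex.norm_real, Real.norm_of_nonneg hGpos.le, mul_comm]
  refine mul_le_mul_of_nonneg_right ?_ hGpos.le
  refine (Finset.norm_prod_one_add_sub_one_le _ _).trans ?_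
  refine sub_le_sub_right (Real.exp_le_exp.2 ?_) 1
  have hb : ∀ x ∈ Finset.univ, ‖bernoulliChar p (combo φ θ x) / g x - 1‖
      ≤ v * (2 * Real.pi * r) ^ 3 := by
    intro x _
    have h1 : 2 * Real.pi * |combo φ θ x| ≤ 2 * Real.pi * r := by
      have := hθ x
      gcongr
    refine (norm_bernoulliChar_div_sub_one_le hp0 hp1 (h1.trans hr)).trans ?_
    gcongr
  refine (Finset.sum_le_card_nsmul _ _ _ hb).trans ?_
  rw [nsmul_eq_mul, Finset.card_univ]
  exact le_of_eq (by ring)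

/-- Quantitative comparison of the integral of the characteristic function over the cube with
the full Gaussian integral. -/
theorem norm_integral_charFn_sub_le {U B : Type*} [Fintype U] [Fintype B] {φ : U → B → ℝ}
    (hφ : ∀ u x, |φ u x| ≤ 1) {p r κ A J : ℝ} (hp0 : 0 < p) (hp1 : p < 1)
    (hInt : ∀ v, 0 < v → Integrable (gaussFn φ v))
    (hJ : ∫ θ, gaussFn φ (p * (1 - p)) θ = J)
    (hA : ∫ θ, gaussFn φ (p * (1 - p) / 2) θ ≤ A * J)
    (hκ : 0 ≤ κ) (hr0 : 0 ≤ r) (hr : 2 * Real.pi * r ≤ 1)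
    (hG : ∀ θ, κ * (∑ u, |θ u|) ^ 2 ≤ 2 * Real.pi ^ 2 * (p * (1 - p)) * ∑ x, combo φ θ x ^ 2)
    (hF : ∀ θ : U → ℝ, κ * (∑ u, |θ u - round (θ u)|) ^ 2
      ≤ 8 * (p * (1 - p)) * ∑ x, (combo φ θ x - round (combo φ θ x)) ^ 2) :
    ‖(∫ θ in cube U, charFn φ p θ) - J‖ ≤ Real.exp (-(κ * r ^ 2))
      + Real.exp (-(κ * r ^ 2 / 2)) * (A * J)
      + (Real.exp (p * (1 - p) * Fintype.card B * (2 * Real.pi * r) ^ 3) - 1) * J := by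
  have hpi := Real.pi_gt_three
  set v := p * (1 - p) with hv
  have hv0 : 0 < v := mul_pos hp0 (by linarith)
  set C : Set (U → ℝ) := {θ | ∑ u, |θ u| ≤ r} with hC
  have hCm : MeasurableSet C := by
    refine (isClosed_le ?_ continuous_const).measurableSet
    fun_prop
  have hCc : C ⊆ cube U := by
    intro θ hθ u _
    have h1 : |θ u| ≤ r := le_trans
      (Finset.single_le_sum (f := fun u => |θ u|) (fun _ _ => abs_nonneg _) (Finset.mem_univ u)) hθ
    have h2 := abs_le.1 h1
    constructor <;> nlinarith
  have hfin : IsFiniteMeasure (volume.restrict (cube U)) :=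
    ⟨by rw [Measure.restrict_apply_univ, volume_cube]; exact ENNReal.one_lt_top⟩
  have hFint : IntegrableOn (charFn φ p) (cube U) := by
    refine Integrable.of_bound (C := 1) (continuous_charFn φ p).aestronglyMeasurable
      (Filter.Eventually.of_forall fun θ => ?_)
    refine (norm_charFn_le φ hp0.le hp1.le θ).trans (Real.exp_le_one_iff.2 ?_)
    have : 0 ≤ ∑ x, (combo φ θ x - round (combo φ θ x)) ^ 2 :=
      Finset.sum_nonneg fun _ _ => sq_nonneg _
    have := mul_nonneg (mul_nonneg (by norm_num : (0 : ℝ) ≤ 8) hv0.le) this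
    linarith
  have hGint := hInt v hv0
  have hGint2 := hInt (v / 2) (by positivity)
  have hGintC : Integrable (fun θ => (gaussFn φ v θ : ℂ)) := hGint.ofReal
  have hGnn : ∀ v θ, 0 ≤ gaussFn φ v θ := fun v θ => Real.exp_nonneg _
  have hsplit : (∫ θ in cube U, charFn φ p θ) - J =
      (∫ θ in C, (charFn φ p θ - gaussFn φ v θ)) + (∫ θ in cube U \ C, charFn φ p θ)
        - ((∫ θ in Cᶜ, gaussFn φ v θ : ℝ) : ℂ) := by
    rw [← integral_inter_add_sdiff hCm hFint, Set.inter_eq_self_of_subset_right hCc,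
      integral_sub (hFint.mono_set hCc) hGintC.integrableOn, ← hJ,
      ← integral_add_compl hCm hGint, integral_complex_ofReal]
    push_cast
    ring
  have hb1 : ‖∫ θ in C, (charFn φ p θ - gaussFn φ v θ)‖
      ≤ (Real.exp (v * Fintype.card B * (2 * Real.pi * r) ^ 3) - 1) * J := by
    have hc0 : 0 ≤ Real.exp (v * Fintype.card B * (2 * Real.pi * r) ^ 3) - 1 := by
      have : 0 ≤ v * Fintype.card B * (2 * Real.pi * r) ^ 3 := by positivity
      have := Real.one_le_exp this
      linarith
    refine (norm_integral_le_integral_norm _).trans ?_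
    rw [← hJ, ← integral_const_mul]
    refine le_trans (setIntegral_mono_on (g := fun θ =>
      (Real.exp (v * Fintype.card B * (2 * Real.pi * r) ^ 3) - 1) * gaussFn φ v θ)
      ((hFint.mono_set hCc).sub hGintC.integrableOn).norm
      (hGint.const_mul _).integrableOn hCm fun θ hθ =>
        norm_charFn_sub_gaussFn_le hp0.le hp1.le hr fun x =>
          (abs_combo_le hφ θ x).trans hθ) ?_
    exact setIntegral_le_integral (hGint.const_mul _)
      (Filter.Eventually.of_forall fun θ => mul_nonneg hc0 (hGnn _ _))
  have hb2 : ‖∫ θ in cube U \ C, charFn φ p θ‖ ≤ Real.exp (-(κ * r ^ 2)) := by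
    have hvol : volume (cube U \ C) ≤ 1 :=
      (measure_mono Set.sdiff_subset).trans (volume_cube U).le
    refine (norm_setIntegral_le_of_norm_le_const (C := Real.exp (-(κ * r ^ 2)))
      (hvol.trans_lt ENNReal.one_lt_top) fun θ hθ => ?_).trans ?_
    · refine (norm_charFn_le φ hp0.le hp1.le θ).trans (Real.exp_le_exp.2 (neg_le_neg ?_))
      refine le_trans ?_ (hF θ)
      have h0 : ∀ u, |θ u - round (θ u)| = |θ u| := by
        intro u
        have hu := hθ.1 u (Set.mem_univ u)
        rcases eq_or_lt_of_le hu.2 with h | h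
        · rw [h]
          have : round (1 / 2 : ℝ) = 1 := by rw [round_eq]; norm_num
          rw [this]; norm_num [abs_of_pos]
        · rw [round_eq_zero_iff.2 ⟨hu.1.le, h⟩]; simp
      simp only [h0]
      have h1 : r ≤ ∑ u, |θ u| := (not_le.1 hθ.2).le
      gcongr
    · refine mul_le_of_le_one_right (Real.exp_nonneg _) ?_
      exact ENNReal.toReal_le_of_le_ofReal zero_le_one (by simpa using hvol)
  have hb3 : ‖((∫ θ in Cᶜ, gaussFn φ v θ : ℝ) : ℂ)‖
      ≤ Real.exp (-(κ * r ^ 2 / 2)) * (A * J) := by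
    rw [Complex.norm_real, Real.norm_of_nonneg (integral_nonneg fun θ => hGnn _ _)]
    refine le_trans ?_ (mul_le_mul_of_nonneg_left hA (Real.exp_nonneg _))
    rw [← integral_const_mul]
    refine le_trans (setIntegral_mono_on (g := fun θ =>
      Real.exp (-(κ * r ^ 2 / 2)) * gaussFn φ (v / 2) θ) hGint.integrableOn
      (hGint2.const_mul _).integrableOn hCm.compl fun θ hθ => ?_) ?_
    · rw [gaussFn, gaussFn, ← Real.exp_add]
      refine Real.exp_le_exp.2 ?_
      have h1 : r ≤ ∑ u, |θ u| := (lt_of_not_ge fun h => hθ h).le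
      have h2 : κ * r ^ 2 ≤ κ * (∑ u, |θ u|) ^ 2 := by gcongr
      have h3 := hG θ
      linarith
    · exact setIntegral_le_integral (hGint2.const_mul _)
        (Filter.Eventually.of_forall fun θ => mul_nonneg (Real.exp_nonneg _) (hGnn _ _))
  rw [hsplit]
  have t1 := norm_sub_le ((∫ θ in C, (charFn φ p θ - gaussFn φ v θ))
    + (∫ θ in cube U \ C, charFn φ p θ)) ((∫ θ in Cᶜ, gaussFn φ v θ : ℝ) : ℂ)
  have t2 := norm_add_le (∫ θ in C, (charFn φ p θ - gaussFn φ v θ))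
    (∫ θ in cube U \ C, charFn φ p θ)
  linarith

/-- The support of a word: the coordinates where it is nonzero. -/
def wordSupp {q n : ℕ} [NeZero q] (u : Fin n → Fin q) : Finset (Fin n) :=
  Finset.univ.filter fun i => u i ≠ 0

/-- Words of length `n` over `Fin q` with at most `t` nonzero coordinates. -/
abbrev LowWord (q n t : ℕ) [NeZero q] : Type :=
  {u : Fin n → Fin q // (wordSupp u).card ≤ t}

/-- The function on `Fin q` which is constant `1` for `a = 0` and the indicator of `a`
otherwise. -/
def letterFn {q : ℕ} [NeZero q] (a b : Fin q) : ℝ := if a = 0 ∨ b = a then 1 else 0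

/-- The indicator that a word agrees with `u` on the support of `u`. -/
def wordFn {q n : ℕ} [NeZero q] (u x : Fin n → Fin q) : ℝ := ∏ i, letterFn (u i) (x i)

/-- `wordFn` for words with at most `t` nonzero coordinates. -/
def lowFn (q n t : ℕ) [NeZero q] (u : LowWord q n t) (x : Fin n → Fin q) : ℝ := wordFn u.1 x

lemma mem_wordSupp {q n : ℕ} [NeZero q] {u : Fin n → Fin q} {i : Fin n} :
    i ∈ wordSupp u ↔ u i ≠ 0 := by simp [wordSupp]

lemma letterFn_zero_left {q : ℕ} [NeZero q] (b : Fin q) : letterFn 0 b = 1 := by simp [letterFn]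

lemma wordFn_eq_ite {q n : ℕ} [NeZero q] (u x : Fin n → Fin q) :
    wordFn u x = if ∀ i, u i = 0 ∨ x i = u i then 1 else 0 := by
  simp only [wordFn, letterFn]
  rw [Finset.prod_ite_zero]
  simp

lemma abs_wordFn_le {q n : ℕ} [NeZero q] (u x : Fin n → Fin q) : |wordFn u x| ≤ 1 := by
  rw [wordFn_eq_ite]; split_ifs <;> simp

/-- Signed sum of the values of `f` at points obtained from `x` and `y` by mixing coordinates. -/
def mixedDiff {q n : ℕ} (f : (Fin n → Fin q) → ℝ) (x y : Fin n → Fin q) (E : Finset (Fin n)) : ℝ :=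
  ∑ s ∈ E.powerset, (-1) ^ s.card * f ((E \ s).piecewise x y)

lemma mixedDiff_wordFn {q n : ℕ} [NeZero q] (u x y : Fin n → Fin q) (E : Finset (Fin n)) :
    mixedDiff (wordFn u) x y E =
      (∏ i ∈ E, (letterFn (u i) (x i) - letterFn (u i) (y i)))
        * ∏ i ∈ Eᶜ, letterFn (u i) (y i) := by
  rw [Finset.prod_sub, Finset.sum_mul, mixedDiff]
  refine Finset.sum_congr rfl fun s hs => ?_
  have hsE := Finset.mem_powerset.1 hs
  rw [mul_assoc, mul_assoc]
  congr 1
  rw [wordFn, ← Finset.prod_mul_prod_compl (E \ s)]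
  congr 1
  · exact Finset.prod_congr rfl fun i hi => by rw [Finset.piecewise_eq_of_mem _ _ _ hi]
  · have hd : Disjoint s Eᶜ :=
      Finset.disjoint_left.2 fun i hi h => (Finset.mem_compl.1 h) (hsE hi)
    rw [← Finset.prod_union hd]
    refine Finset.prod_congr ?_ fun i hi => ?_
    · ext i
      simp only [Finset.mem_compl, Finset.mem_sdiff, Finset.mem_union, not_and, not_not]
      tauto
    · have hi' : i ∉ E \ s := by
        simp only [Finset.mem_compl, Finset.mem_sdiff, Finset.mem_union, not_and, not_not] at hi ⊢
        rcases hi with h | h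
        · exact fun _ => h
        · exact fun h' => absurd h' h
      rw [Finset.piecewise_eq_of_notMem _ _ _ hi']

lemma mixedDiff_wordFn_eq_zero {q n : ℕ} [NeZero q] {u : Fin n → Fin q} (x y : Fin n → Fin q)
    {E : Finset (Fin n)} (h : ¬ E ⊆ wordSupp u) : mixedDiff (wordFn u) x y E = 0 := by
  obtain ⟨i, hi, hu⟩ := Finset.not_subset.1 h
  rw [mem_wordSupp, not_not] at hu
  rw [mixedDiff_wordFn, Finset.prod_eq_zero hi (by rw [hu]; simp [letterFn_zero_left]), zero_mul]

lemma sum_mixedDiff_wordFn {q n t : ℕ} [NeZero q] {u : Fin n → Fin q}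
    (hu : (wordSupp u).card ≤ t) (x y : Fin n → Fin q) :
    ∑ E : Finset (Fin n) with E.card ≤ t, mixedDiff (wordFn u) x y E = wordFn u x := by
  have h1 : wordFn u x = ∑ E : Finset (Fin n), mixedDiff (wordFn u) x y E := by
    simp only [mixedDiff_wordFn]
    rw [← Fintype.prod_add, wordFn]
    exact Finset.prod_congr rfl fun i _ => by ring
  rw [h1, Finset.sum_filter]
  refine Finset.sum_congr rfl fun E _ => ?_
  split_ifs with h
  · rfl
  · exact (mixedDiff_wordFn_eq_zero x y fun hE => h ((Finset.card_le_card hE).trans hu)).symm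

lemma mixedDiff_combo {q n t : ℕ} [NeZero q] (θ : LowWord q n t → ℝ) (x y : Fin n → Fin q)
    (E : Finset (Fin n)) :
    mixedDiff (combo (lowFn q n t) θ) x y E = ∑ u, θ u * mixedDiff (wordFn u.1) x y E := by
  simp only [mixedDiff, combo, lowFn, Finset.mul_sum]
  rw [Finset.sum_comm]
  exact Finset.sum_congr rfl fun u _ => Finset.sum_congr rfl fun s _ => by ring

lemma combo_eq_sum_mixedDiff {q n t : ℕ} [NeZero q] (θ : LowWord q n t → ℝ)
    (x y : Fin n → Fin q) :
    combo (lowFn q n t) θ x =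
      ∑ E : Finset (Fin n) with E.card ≤ t, mixedDiff (combo (lowFn q n t) θ) x y E := by
  simp only [mixedDiff_combo]
  rw [Finset.sum_comm]
  simp only [← Finset.mul_sum]
  exact Finset.sum_congr rfl fun u _ => by rw [sum_mixedDiff_wordFn u.2, lowFn]

lemma coeff_eq_mixedDiff {q n t : ℕ} [NeZero q] (θ : LowWord q n t → ℝ) (u : LowWord q n t) :
    θ u = mixedDiff (combo (lowFn q n t) θ) u.1 0 (wordSupp u.1) := by
  rw [mixedDiff_combo, Finset.sum_eq_single u]
  · have : mixedDiff (wordFn u.1) u.1 0 (wordSupp u.1) = 1 := by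
      rw [mixedDiff_wordFn, Finset.prod_eq_one, Finset.prod_eq_one, one_mul]
      · intro i hi
        rw [Finset.mem_compl, mem_wordSupp, not_not] at hi
        simp [letterFn, hi]
      · intro i hi
        rw [mem_wordSupp] at hi
        simp [letterFn, hi, Ne.symm hi]
    rw [this, mul_one]
  · intro v _ hv
    suffices mixedDiff (wordFn v.1) u.1 0 (wordSupp u.1) = 0 by rw [this, mul_zero]
    by_contra hne
    apply hv
    rw [← ne_eq, mixedDiff_wordFn, mul_ne_zero_iff, Finset.prod_ne_zero_iff,
      Finset.prod_ne_zero_iff] at hne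
    refine Subtype.ext (funext fun i => ?_)
    by_cases hi : i ∈ wordSupp u.1
    · have h1 := hne.1 i hi
      have hi' := mem_wordSupp.1 hi
      by_contra h
      apply h1
      by_cases h0 : v.1 i = 0
      · simp [h0, letterFn]
      · simp [letterFn, h0, Ne.symm h, Ne.symm h0]
    · have h1 := hne.2 i (Finset.mem_compl.2 hi)
      rw [mem_wordSupp, not_not] at hi
      rw [hi]
      by_contra h
      apply h1
      simp [letterFn, h, Ne.symm h]
  · intro h; exact absurd (Finset.mem_univ u) h

lemma norm_map_mixedDiff_le {q n : ℕ} {G : Type*} [SeminormedAddCommGroup G] (ρ : ℝ →+ G)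
    (f : (Fin n → Fin q) → ℝ) (x y : Fin n → Fin q) (E : Finset (Fin n)) :
    ‖ρ (mixedDiff f x y E)‖ ≤ ∑ s ∈ E.powerset, ‖ρ (f ((E \ s).piecewise x y))‖ := by
  rw [mixedDiff, map_sum]
  refine (norm_sum_le _ _).trans (le_of_eq (Finset.sum_congr rfl fun s _ => ?_))
  rcases neg_one_pow_eq_or ℝ s.card with h | h <;> simp [h]

lemma sum_piecewise_le {q n : ℕ} [NeZero q] {h : (Fin n → Fin q) → ℝ} (hh : ∀ z, 0 ≤ h z)
    (x : Fin n → Fin q) (R : Finset (Fin n)) :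
    ∑ y : Fin n → Fin q, h (R.piecewise x y) ≤ (q : ℝ) ^ R.card * ∑ z, h z := by
  classical
  rw [← Finset.sum_fiberwise Finset.univ (fun y => R.piecewise x y), Finset.mul_sum]
  refine Finset.sum_le_sum fun z _ => ?_
  have h1 : ∀ y ∈ Finset.univ.filter (fun y => R.piecewise x y = z),
      h (R.piecewise x y) = h z := fun y hy => by rw [(Finset.mem_filter.1 hy).2]
  rw [Finset.sum_congr rfl h1, Finset.sum_const, nsmul_eq_mul]
  refine mul_le_mul_of_nonneg_right ?_ (hh z)
  have h2 : (Finset.univ.filter (fun y => R.piecewise x y = z)).card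
      ≤ (Finset.univ : Finset (R → Fin q)).card := by
    refine Finset.card_le_card_of_injOn (fun y i => y i) (fun _ _ => Finset.mem_univ _) ?_
    intro y hy y' hy' hyy
    funext i
    by_cases hi : i ∈ R
    · exact congr_fun hyy ⟨i, hi⟩
    · have e := (Finset.mem_filter.1 hy).2.trans (Finset.mem_filter.1 hy').2.symm
      have := congr_fun e i
      simpa [Finset.piecewise_eq_of_notMem _ _ _ hi] using this
  have h3 : (Finset.univ : Finset (R → Fin q)).card = q ^ R.card := by
    simp
  rw [h3] at h2
  exact_mod_cast h2

/-- Local decoding: a value of a low-degree function is controlled by its mean square. -/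
lemma norm_map_combo_sq_le {q n t : ℕ} [NeZero q] {G : Type*} [SeminormedAddCommGroup G]
    (ρ : ℝ →+ G) (θ : LowWord q n t → ℝ) (x : Fin n → Fin q) :
    (q : ℝ) ^ n * ‖ρ (combo (lowFn q n t) θ x)‖ ^ 2 ≤
      (2 ^ t * (Finset.univ.filter fun E : Finset (Fin n) => E.card ≤ t).card : ℝ) ^ 2
        * (q : ℝ) ^ t * ∑ z, ‖ρ (combo (lowFn q n t) θ z)‖ ^ 2 := by
  classical
  set F := combo (lowFn q n t) θ with hF
  set 𝓔 := Finset.univ.filter fun E : Finset (Fin n) => E.card ≤ t with h𝓔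
  set I := 𝓔.sigma fun E => E.powerset with hI
  have hq : (1 : ℝ) ≤ q := by exact_mod_cast NeZero.one_le
  have hcard : (I.card : ℝ) ≤ 2 ^ t * 𝓔.card := by
    have h1 : I.card ≤ 𝓔.card * 2 ^ t := by
      rw [hI, Finset.card_sigma]
      refine Finset.sum_le_card_nsmul _ _ _ fun E hE => ?_
      rw [Finset.card_powerset]
      exact Nat.pow_le_pow_right (by norm_num) (Finset.mem_filter.1 hE).2
    calc (I.card : ℝ) ≤ ((𝓔.card * 2 ^ t : ℕ) : ℝ) := by exact_mod_cast h1
      _ = _ := by push_cast; ring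
  have hpt : ∀ y, ‖ρ (F x)‖ ^ 2 ≤ I.card * ∑ i ∈ I, ‖ρ (F ((i.1 \ i.2).piecewise x y))‖ ^ 2 := by
    intro y
    have h1 : ‖ρ (F x)‖ ≤ ∑ i ∈ I, ‖ρ (F ((i.1 \ i.2).piecewise x y))‖ := by
      rw [hI, Finset.sum_sigma, hF, combo_eq_sum_mixedDiff θ x y, map_sum]
      exact (norm_sum_le _ _).trans (Finset.sum_le_sum fun E _ => norm_map_mixedDiff_le _ _ _ _ _)
    calc ‖ρ (F x)‖ ^ 2 ≤ (∑ i ∈ I, ‖ρ (F ((i.1 \ i.2).piecewise x y))‖) ^ 2 := by gcongr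
      _ ≤ _ := sq_sum_le_card_mul_sum_sq
  have hsum := Finset.sum_le_sum fun y (_ : y ∈ (Finset.univ : Finset (Fin n → Fin q))) => hpt y
  rw [Finset.sum_const, Finset.card_univ, ← Finset.mul_sum, Finset.sum_comm, nsmul_eq_mul] at hsum
  simp only [Fintype.card_fun, Fintype.card_fin] at hsum
  push_cast at hsum
  refine hsum.trans ?_
  have hS : 0 ≤ ∑ z, ‖ρ (F z)‖ ^ 2 := Finset.sum_nonneg fun _ _ => sq_nonneg _
  have h2 : ∑ i ∈ I, ∑ y, ‖ρ (F ((i.1 \ i.2).piecewise x y))‖ ^ 2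
      ≤ I.card * ((q : ℝ) ^ t * ∑ z, ‖ρ (F z)‖ ^ 2) := by
    rw [← nsmul_eq_mul]
    refine Finset.sum_le_card_nsmul _ _ _ fun i hi => ?_
    refine (sum_piecewise_le (h := fun z => ‖ρ (F z)‖ ^ 2) (fun _ => sq_nonneg _) x _).trans ?_
    have hi1 : i.1.card ≤ t := (Finset.mem_filter.1 (Finset.mem_sigma.1 hi).1).2
    have : (i.1 \ i.2).card ≤ t := (Finset.card_le_card Finset.sdiff_subset).trans hi1
    gcongr
  calc (I.card : ℝ) * ∑ i ∈ I, ∑ y, ‖ρ (F ((i.1 \ i.2).piecewise x y))‖ ^ 2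
      ≤ I.card * (I.card * ((q : ℝ) ^ t * ∑ z, ‖ρ (F z)‖ ^ 2)) := by gcongr
    _ = (I.card : ℝ) ^ 2 * (q : ℝ) ^ t * ∑ z, ‖ρ (F z)‖ ^ 2 := by ring
    _ ≤ _ := by gcongr

/-- The coefficients of a low-degree function are controlled by its mean square. -/
theorem sum_norm_map_coeff_sq_le {q n t : ℕ} [NeZero q] {G : Type*} [SeminormedAddCommGroup G]
    (ρ : ℝ →+ G) (θ : LowWord q n t → ℝ) :
    (q : ℝ) ^ n * (∑ u, ‖ρ (θ u)‖) ^ 2 ≤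
      (Fintype.card (LowWord q n t) * 4 ^ t *
        (Finset.univ.filter fun E : Finset (Fin n) => E.card ≤ t).card : ℝ) ^ 2
        * (q : ℝ) ^ t * ∑ z, ‖ρ (combo (lowFn q n t) θ z)‖ ^ 2 := by
  classical
  obtain ⟨x, -, hx⟩ := Finset.exists_max_image (Finset.univ : Finset (Fin n → Fin q))
    (fun z => ‖ρ (combo (lowFn q n t) θ z)‖) ⟨0, Finset.mem_univ _⟩
  have h1 : ∑ u, ‖ρ (θ u)‖ ≤
      Fintype.card (LowWord q n t) * 2 ^ t * ‖ρ (combo (lowFn q n t) θ x)‖ := by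
    rw [mul_assoc, ← nsmul_eq_mul, ← Finset.card_univ]
    refine Finset.sum_le_card_nsmul _ _ _ fun u _ => ?_
    rw [coeff_eq_mixedDiff θ u]
    refine (norm_map_mixedDiff_le _ _ _ _ _).trans ?_
    refine (Finset.sum_le_card_nsmul _ _ _ fun s _ => hx _ (Finset.mem_univ _)).trans ?_
    rw [nsmul_eq_mul, Finset.card_powerset]
    push_cast
    have := u.2
    gcongr
    norm_num
  have h2 := norm_map_combo_sq_le ρ θ x
  calc (q : ℝ) ^ n * (∑ u, ‖ρ (θ u)‖) ^ 2
      ≤ (q : ℝ) ^ n * (Fintype.card (LowWord q n t) * 2 ^ t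
          * ‖ρ (combo (lowFn q n t) θ x)‖) ^ 2 := by
        have : 0 ≤ ∑ u, ‖ρ (θ u)‖ := Finset.sum_nonneg fun _ _ => norm_nonneg _
        gcongr
    _ = (Fintype.card (LowWord q n t) * 2 ^ t : ℝ) ^ 2 *
          ((q : ℝ) ^ n * ‖ρ (combo (lowFn q n t) θ x)‖ ^ 2) := by ring
    _ ≤ (Fintype.card (LowWord q n t) * 2 ^ t : ℝ) ^ 2 * _ :=
        mul_le_mul_of_nonneg_left h2 (by positivity)
    _ = _ := by
        have : (4 : ℝ) ^ t = 2 ^ t * 2 ^ t := by rw [← mul_pow]; norm_num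
        rw [this]; ring

/-- The Gram–Schmidt orthogonalization of the functions `letterFn a`, in increasing order of
`a`. -/
noncomputable def orthLetter {q : ℕ} [NeZero q] (a x : Fin q) : ℝ :=
  if a = 0 then 1
  else (if x = a then 1 else 0) - (if x = 0 ∨ a ≤ x then 1 else 0) / ((q : ℝ) - a + 1)

/-- The coefficients of `orthLetter` with respect to `letterFn`. -/
noncomputable def letterCoeff {q : ℕ} [NeZero q] (a b : Fin q) : ℝ :=
  if a = 0 then (if b = 0 then 1 else 0)
  else (if b = a then 1 else 0)
    - (if b = 0 then 1 else if b < a then -1 else 0) / ((q : ℝ) - a + 1)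

/-- The squared norm of `orthLetter`. -/
noncomputable def letterNorm {q : ℕ} [NeZero q] (a : Fin q) : ℝ :=
  if a = 0 then (q : ℝ) else ((q : ℝ) - a) / ((q : ℝ) - a + 1)

lemma cast_fin_lt {q : ℕ} (a : Fin q) : (a : ℝ) < q := by exact_mod_cast a.2

lemma letterCoeff_self {q : ℕ} [NeZero q] (a : Fin q) : letterCoeff a a = 1 := by
  unfold letterCoeff
  split_ifs <;> simp_all

lemma le_of_letterCoeff_ne_zero {q : ℕ} [NeZero q] {a b : Fin q} (h : letterCoeff a b ≠ 0) :
    b ≤ a := by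
  by_contra hlt
  rw [not_le] at hlt
  apply h
  have hb : b ≠ 0 := (lt_of_le_of_lt (Fin.zero_le a) hlt).ne'
  simp [letterCoeff, hb, hlt.ne', hlt.not_gt]

lemma letterNorm_pos {q : ℕ} [NeZero q] (a : Fin q) : 0 < letterNorm a := by
  have := cast_fin_lt a
  have hq : (0 : ℝ) < q := by exact_mod_cast NeZero.pos q
  unfold letterNorm
  split_ifs
  · exact hq
  · exact div_pos (by linarith) (by linarith)

lemma sum_letterCoeff_mul {q : ℕ} [NeZero q] (a x : Fin q) :
    ∑ b, letterCoeff a b * letterFn b x = orthLetter a x := by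
  by_cases ha : a = 0
  · simp [letterCoeff, orthLetter, ha, letterFn_zero_left]
  · have h : ∀ b, letterCoeff a b * letterFn b x =
        (if b = a then letterFn a x else 0) - (if b = 0 then 1 else 0) / ((q : ℝ) - a + 1)
          + (if b = x then (if x ≠ 0 ∧ x < a then 1 else 0) else 0) / ((q : ℝ) - a + 1) := by
      intro b
      by_cases hb : b = 0
      · subst hb
        have h0 : (0 : Fin q) ≠ a := Ne.symm ha
        by_cases hx : (0 : Fin q) = x
        · subst hx; simp [letterCoeff, ha, h0, letterFn_zero_left]
        · simp [letterCoeff, ha, h0, hx, letterFn_zero_left]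
      · by_cases hba : b = a
        · subst hba
          by_cases hx : b = x
          · subst hx; simp [letterCoeff, ha]
          · simp [letterCoeff, ha, hx]
        · by_cases hx : b = x
          · subst hx
            by_cases hlt : b < a <;> simp [letterCoeff, ha, hb, hba, hlt, letterFn, neg_div]
          · simp [hb, hba, hx, letterFn, Ne.symm hx]
    simp only [h]
    rw [Finset.sum_add_distrib, Finset.sum_sub_distrib, ← Finset.sum_div, ← Finset.sum_div]
    simp only [Finset.sum_ite_eq', Finset.mem_univ, if_true]
    unfold orthLetter
    rw [if_neg ha, letterFn]
    by_cases hx : x = 0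
    · simp [hx, ha]
    · by_cases hxa : a ≤ x
      · simp [hx, hxa, ha, not_lt.2 hxa]
      · simp [hx, hxa, ha, not_le.1 hxa, sub_add_cancel]

lemma sum_tail_indicator {q : ℕ} [NeZero q] {a : Fin q} (ha : a ≠ 0) :
    ∑ x : Fin q, (if x = 0 ∨ a ≤ x then (1 : ℝ) else 0) = (q : ℝ) - a + 1 := by
  have h : ∀ x : Fin q, (if x = 0 ∨ a ≤ x then (1 : ℝ) else 0)
      = (if x = 0 then 1 else 0) + (if x ∈ Finset.Ici a then 1 else 0) := by
    intro x
    simp only [Finset.mem_Ici]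
    by_cases hx : x = 0
    · subst hx
      have : ¬ a ≤ 0 := fun h => ha (le_antisymm h (Fin.zero_le a))
      simp [this]
    · simp [hx]
  simp only [h]
  rw [Finset.sum_add_distrib, Finset.sum_ite_mem, Finset.sum_const, Finset.univ_inter,
    Fin.card_Ici, nsmul_eq_mul, Nat.cast_sub a.2.le]
  simp
  ring

lemma sum_orthLetter {q : ℕ} [NeZero q] {a : Fin q} (ha : a ≠ 0) : ∑ x, orthLetter a x = 0 := by
  have h1 := cast_fin_lt a
  simp only [orthLetter, if_neg ha]
  rw [Finset.sum_sub_distrib, ← Finset.sum_div, sum_tail_indicator ha, div_self (by linarith)]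
  simp

lemma sum_orthLetter_mul_of_lt {q : ℕ} [NeZero q] {a a' : Fin q} (h : a < a') :
    ∑ x, orthLetter a x * orthLetter a' x = 0 := by
  have ha' : a' ≠ 0 := (lt_of_le_of_lt (Fin.zero_le a) h).ne'
  have hk : ∀ x, orthLetter a x * orthLetter a' x = orthLetter a a' * orthLetter a' x := by
    intro x
    by_cases ha : a = 0
    · simp [orthLetter, ha]
    · by_cases hx : x = 0 ∨ a' ≤ x
      · congr 1
        have hxa : x ≠ a := by
          rintro rfl
          rcases hx with hx | hx
          · exact ha hx
          · exact absurd h hx.not_gt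
        have hx' : x = 0 ∨ a ≤ x := hx.imp_right h.le.trans
        simp [orthLetter, ha, hxa, hx', h.ne', h.le]
      · have hxa : x ≠ a' := by rintro rfl; exact hx (Or.inr le_rfl)
        simp [orthLetter, ha', hx, hxa]
  simp only [hk]
  rw [← Finset.mul_sum, sum_orthLetter ha', mul_zero]

lemma sum_orthLetter_mul {q : ℕ} [NeZero q] (a a' : Fin q) :
    ∑ x, orthLetter a x * orthLetter a' x = if a = a' then letterNorm a else 0 := by
  split_ifs with h
  · subst h
    by_cases ha : a = 0
    · simp [orthLetter, letterNorm, ha]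
    · have h1 := cast_fin_lt a
      have hd : (q : ℝ) - a + 1 ≠ 0 := by linarith
      have e : ∀ x, orthLetter a x * orthLetter a x
          = (if x = a then 1 - 2 / ((q : ℝ) - a + 1) else 0)
            + (if x = 0 ∨ a ≤ x then 1 else 0) / ((q : ℝ) - a + 1) ^ 2 := by
        intro x
        by_cases hx : x = a
        · subst hx
          simp [orthLetter, ha]
          field_simp
          ring
        · by_cases hx' : x = 0 ∨ a ≤ x
          · simp only [orthLetter, ha, hx, hx', if_true, if_false, zero_sub, neg_mul_neg, zero_add]
            rw [div_mul_div_comm, one_mul, sq]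
          · simp [orthLetter, ha, hx, hx']
      simp only [e]
      rw [Finset.sum_add_distrib, ← Finset.sum_div, sum_tail_indicator ha]
      simp only [Finset.sum_ite_eq', Finset.mem_univ, if_true, letterNorm, if_neg ha]
      field_simp
      ring
  · rcases lt_or_gt_of_ne h with h | h
    · exact sum_orthLetter_mul_of_lt h
    · rw [← sum_orthLetter_mul_of_lt h]
      exact Finset.sum_congr rfl fun x _ => mul_comm _ _

lemma prod_letterNorm (q : ℕ) [NeZero q] : ∏ a : Fin q, letterNorm a = 1 := by
  obtain ⟨m, rfl⟩ := Nat.exists_eq_succ_of_ne_zero (NeZero.ne q)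
  have h : ∀ k ≤ m, ∏ i ∈ Finset.range k, (((m : ℝ) - i) / (m - i + 1))
      = (m + 1 - k) / (m + 1) := by
    intro k
    induction k with
    | zero =>
      intro _
      have : (m : ℝ) + 1 ≠ 0 := by positivity
      simp [this]
    | succ k ih =>
      intro hk
      have hk' : (k : ℝ) + 1 ≤ m := by exact_mod_cast hk
      rw [Finset.prod_range_succ, ih (by omega)]
      have : (m : ℝ) + 1 ≠ 0 := by positivity
      have h2 : (m : ℝ) - k + 1 ≠ 0 := by linarith
      push_cast
      field_simp
      ring
  rw [Fin.prod_univ_succ]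
  have e : ∀ i : Fin m, letterNorm (q := m.succ) i.succ
      = ((m : ℝ) - (i : ℕ)) / (m - (i : ℕ) + 1) := by
    intro i
    rw [letterNorm, if_neg (Fin.succ_ne_zero i)]
    rw [Fin.val_succ]
    push_cast
    congr 1 <;> ring
  simp only [e]
  rw [Fin.prod_univ_eq_prod_range (fun i : ℕ => ((m : ℝ) - i) / (m - i + 1)) m, h m le_rfl]
  have : (m : ℝ) + 1 ≠ 0 := by positivity
  simp [letterNorm]
  field_simp

/-- Product version of `orthLetter`. -/
noncomputable def orthWord {q n : ℕ} [NeZero q] (u x : Fin n → Fin q) : ℝ :=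
  ∏ i, orthLetter (u i) (x i)

/-- Change of basis from `orthWord` to `wordFn` on words of low weight. -/
noncomputable def orthMatrix (q n t : ℕ) [NeZero q] :
    Matrix (LowWord q n t) (LowWord q n t) ℝ :=
  Matrix.of fun v u => ∏ i, letterCoeff (u.1 i) (v.1 i)

lemma le_of_prod_letterCoeff_ne_zero {q n : ℕ} [NeZero q] {u v : Fin n → Fin q}
    (h : ∏ i, letterCoeff (u i) (v i) ≠ 0) : v ≤ u := fun i =>
  le_of_letterCoeff_ne_zero (Finset.prod_ne_zero_iff.1 h i (Finset.mem_univ i))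

lemma card_wordSupp_mono {q n : ℕ} [NeZero q] {u v : Fin n → Fin q} (h : v ≤ u) :
    (wordSupp v).card ≤ (wordSupp u).card := by
  refine Finset.card_le_card fun i hi => ?_
  rw [mem_wordSupp] at hi ⊢
  intro h0
  have := h i
  rw [h0] at this
  exact hi (le_antisymm this (Fin.zero_le _))

lemma sum_lowWord {q n t : ℕ} [NeZero q] {M : Type*} [AddCommMonoid M]
    (f : (Fin n → Fin q) → M) :
    ∑ v : LowWord q n t, f v.1 = ∑ v, if (wordSupp v).card ≤ t then f v else 0 := by
  rw [← Finset.sum_filter]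
  exact (Finset.sum_subtype _ (by simp) f).symm

lemma sum_orthMatrix_mul {q n t : ℕ} [NeZero q] (u : LowWord q n t) (x : Fin n → Fin q) :
    ∑ v : LowWord q n t, (∏ i, letterCoeff (u.1 i) (v.1 i)) * wordFn v.1 x = orthWord u.1 x := by
  have h1 : orthWord u.1 x = ∑ v : Fin n → Fin q,
      (∏ i, letterCoeff (u.1 i) (v i)) * wordFn v x := by
    simp only [orthWord, ← sum_letterCoeff_mul, wordFn, ← Finset.prod_mul_distrib]
    rw [Finset.prod_univ_sum, Fintype.piFinset_univ]
  rw [h1]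
  rw [sum_lowWord fun v => (∏ i, letterCoeff (u.1 i) (v i)) * wordFn v x]
  refine Finset.sum_congr rfl fun v _ => ?_
  split_ifs with hv
  · rfl
  · by_contra h
    exact hv ((card_wordSupp_mono (le_of_prod_letterCoeff_ne_zero
      (left_ne_zero_of_mul (Ne.symm h)))).trans u.2)

lemma det_orthMatrix (q n t : ℕ) [NeZero q] : (orthMatrix q n t).det = 1 := by
  classical
  have hsum : ∀ {u v : LowWord q n t}, v.1 ≤ u.1 → v ≠ u →
      ∑ i, (v.1 i : ℕ) < ∑ i, (u.1 i : ℕ) := by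
    intro u v hle hne
    have hne' : ∃ i, v.1 i ≠ u.1 i := by
      by_contra h
      push Not at h
      exact hne (Subtype.ext (funext h))
    obtain ⟨i, hi⟩ := hne'
    exact Finset.sum_lt_sum (fun j _ => hle j) ⟨i, Finset.mem_univ i, lt_of_le_of_ne (hle i)
      fun e => hi (Fin.ext e)⟩
  have hbt : (orthMatrix q n t).BlockTriangular fun u => ∑ i, (u.1 i : ℕ) := by
    intro v u huv
    by_contra h
    have hle := le_of_prod_letterCoeff_ne_zero h
    rcases eq_or_ne v u with rfl | hne
    · exact lt_irrefl _ huv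
    · exact lt_asymm huv (hsum hle hne)
  rw [hbt.det]
  refine Finset.prod_eq_one fun k _ => ?_
  have : (orthMatrix q n t).toSquareBlock (fun u => ∑ i, (u.1 i : ℕ)) k = 1 := by
    ext v u
    rw [Matrix.toSquareBlock_def, Matrix.of_apply, Matrix.one_apply]
    split_ifs with h
    · subst h
      rw [orthMatrix, Matrix.of_apply]
      exact Finset.prod_eq_one fun i _ => letterCoeff_self (v.1.1 i)
    · by_contra hne
      have hle := le_of_prod_letterCoeff_ne_zero hne
      have := hsum hle fun e => h (Subtype.ext e)
      rw [v.2, u.2] at this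
      exact lt_irrefl _ this
  rw [this, Matrix.det_one]

lemma sum_orthWord_mul {q n : ℕ} [NeZero q] (u v : Fin n → Fin q) :
    ∑ x, orthWord u x * orthWord v x = if u = v then ∏ i, letterNorm (u i) else 0 := by
  have h : ∑ x, orthWord u x * orthWord v x
      = ∏ i, ∑ b, orthLetter (u i) b * orthLetter (v i) b := by
    simp only [orthWord, ← Finset.prod_mul_distrib]
    rw [Finset.prod_univ_sum, Fintype.piFinset_univ]
  rw [h]
  simp only [sum_orthLetter_mul]
  split_ifs with huv
  · subst huv; simp
  · obtain ⟨i, hi⟩ := Function.ne_iff.1 huv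
    exact Finset.prod_eq_zero (Finset.mem_univ i) (if_neg hi)

lemma sum_combo_orthMatrix_sq (q n t : ℕ) [NeZero q] (η : LowWord q n t → ℝ) :
    ∑ x, combo (lowFn q n t) ((orthMatrix q n t).mulVec η) x ^ 2
      = ∑ u, (∏ i, letterNorm (u.1 i)) * η u ^ 2 := by
  have h : ∀ x, combo (lowFn q n t) ((orthMatrix q n t).mulVec η) x
      = ∑ u, η u * orthWord u.1 x := by
    intro x
    simp only [combo, Matrix.mulVec, dotProduct, ← sum_orthMatrix_mul, Finset.mul_sum,
      Finset.sum_mul, orthMatrix, Matrix.of_apply, lowFn]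
    rw [Finset.sum_comm]
    exact Finset.sum_congr rfl fun u _ => Finset.sum_congr rfl fun v _ => by ring
  have h2 : ∀ x, combo (lowFn q n t) ((orthMatrix q n t).mulVec η) x ^ 2
      = ∑ u, ∑ v, η u * η v * (orthWord u.1 x * orthWord v.1 x) := by
    intro x
    rw [h, sq, Finset.sum_mul_sum]
    exact Finset.sum_congr rfl fun u _ => Finset.sum_congr rfl fun v _ => by ring
  simp only [h2]
  rw [Finset.sum_comm]
  refine Finset.sum_congr rfl fun u _ => ?_
  rw [Finset.sum_comm]
  simp only [← Finset.mul_sum, sum_orthWord_mul]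
  rw [Finset.sum_eq_single u]
  · rw [if_pos rfl]; ring
  · intro v _ hv
    rw [if_neg fun e => hv (Subtype.ext e.symm), mul_zero]
  · intro h; exact absurd (Finset.mem_univ u) h

lemma card_wordSupp_eq_sum {q n : ℕ} [NeZero q] (u : Fin n → Fin q) :
    (wordSupp u).card = ∑ i, if u i = 0 then 0 else 1 := by
  rw [wordSupp, Finset.card_filter]
  exact Finset.sum_congr rfl fun i _ => by split_ifs <;> simp_all

lemma card_filter_wordSupp_eq {q n : ℕ} [NeZero q] (S : Finset (Fin n)) :
    (Finset.univ.filter fun u : Fin n → Fin q => wordSupp u = S).card = (q - 1) ^ S.card := by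
  classical
  have h : (Finset.univ.filter fun u : Fin n → Fin q => wordSupp u = S)
      = Fintype.piFinset fun i => if i ∈ S then {0}ᶜ else {0} := by
    ext u
    simp only [Finset.mem_filter, Finset.mem_univ, true_and, Fintype.mem_piFinset,
      Finset.ext_iff, mem_wordSupp]
    refine forall_congr' fun i => ?_
    by_cases hi : i ∈ S <;> simp [hi]
  rw [h, Fintype.card_piFinset]
  have h2 : ∀ i, (if i ∈ S then ({0}ᶜ : Finset (Fin q)) else {0}).card
      = if i ∈ S then q - 1 else 1 := fun i => by
    split_ifs <;> simp [Finset.card_compl]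
  simp only [h2, Finset.prod_ite_mem, Finset.univ_inter, Finset.prod_const]

lemma card_filter_card_wordSupp_eq (q n s : ℕ) [NeZero q] :
    (Finset.univ.filter fun u : Fin n → Fin q => (wordSupp u).card = s).card
      = n.choose s * (q - 1) ^ s := by
  classical
  have h : (Finset.univ.filter fun u : Fin n → Fin q => (wordSupp u).card = s)
      = (Finset.powersetCard s (Finset.univ : Finset (Fin n))).biUnion
        fun S => Finset.univ.filter fun u : Fin n → Fin q => wordSupp u = S := by
    ext u
    simp [Finset.mem_powersetCard]
  rw [h, Finset.card_biUnion]
  · rw [Finset.sum_congr rfl fun S hS => by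
      rw [card_filter_wordSupp_eq, (Finset.mem_powersetCard.1 hS).2]]
    simp [Finset.card_powersetCard]
  · intro S _ S' _ hne
    refine Finset.disjoint_left.2 fun u hu hu' => hne ?_
    rw [← (Finset.mem_filter.1 hu).2, ← (Finset.mem_filter.1 hu').2]

lemma card_lowWord (q n t : ℕ) [NeZero q] :
    Fintype.card (LowWord q n t) = ∑ i ∈ Finset.range (t + 1), n.choose i * (q - 1) ^ i := by
  classical
  rw [Fintype.card_subtype, Finset.card_eq_sum_card_fiberwise (f := fun u => (wordSupp u).card)
    (t := Finset.range (t + 1))]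
  · refine Finset.sum_congr rfl fun s hs => ?_
    rw [← card_filter_card_wordSupp_eq, Finset.filter_filter]
    congr 1
    ext u
    have := Finset.mem_range.1 hs
    simp only [Finset.mem_filter, Finset.mem_univ, true_and]
    omega
  · intro u hu
    simp only [Finset.coe_filter, Finset.mem_univ, true_and, Set.mem_ofPred_eq] at hu
    simp only [Finset.coe_range, Set.mem_Iio]
    omega

lemma card_filter_card_le (n t : ℕ) :
    (Finset.univ.filter fun E : Finset (Fin n) => E.card ≤ t).card
      = ∑ i ∈ Finset.range (t + 1), n.choose i := by
  classical
  rw [Finset.card_eq_sum_card_fiberwise (f := Finset.card) (t := Finset.range (t + 1))]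
  · refine Finset.sum_congr rfl fun s hs => ?_
    have h : (Finset.univ.filter fun E : Finset (Fin n) => E.card ≤ t).filter (·.card = s)
        = Finset.powersetCard s Finset.univ := by
      ext E
      have := Finset.mem_range.1 hs
      simp only [Finset.mem_filter, Finset.mem_univ, true_and, Finset.mem_powersetCard,
        Finset.subset_univ]
      omega
    rw [h, Finset.card_powersetCard, Finset.card_univ, Fintype.card_fin]
  · intro E hE
    simp only [Finset.coe_filter, Finset.mem_univ, true_and, Set.mem_ofPred_eq] at hE
    simp only [Finset.coe_range, Set.mem_Iio]
    omega

lemma prod_letterNorm_of_card_le (q s t : ℕ) [NeZero q] :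
    (∏ a : Fin q, if (if a = 0 then 0 else 1) + s ≤ t then letterNorm a else 1)
      = if s = t then (q : ℝ) else 1 := by
  rcases lt_trichotomy s t with h | h | h
  · rw [if_neg h.ne, ← prod_letterNorm q]
    refine Finset.prod_congr rfl fun a _ => if_pos ?_
    split_ifs <;> omega
  · subst h
    rw [if_pos rfl, Finset.prod_eq_single 0]
    · simp [letterNorm]
    · intro a _ ha
      simp [ha]
    · simp
  · rw [if_neg h.ne']
    exact Finset.prod_eq_one fun a _ => if_neg (by omega)

lemma prod_letterNorm_coord (q k t : ℕ) [NeZero q] (i : Fin (k + 1)) :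
    (∏ u : Fin (k + 1) → Fin q, if (wordSupp u).card ≤ t then letterNorm (u i) else 1)
      = (q : ℝ) ^ (k.choose t * (q - 1) ^ t) := by
  classical
  rw [← (Fin.insertNthEquiv (fun _ => Fin q) i).prod_comp, Fintype.prod_prod_type_right]
  have h : ∀ (w : Fin k → Fin q) (a : Fin q),
      (wordSupp (Fin.insertNthEquiv (fun _ => Fin q) i (a, w))).card
        = (if a = 0 then 0 else 1) + (wordSupp w).card := fun w a => by
    rw [card_wordSupp_eq_sum, card_wordSupp_eq_sum, Fin.sum_univ_succAbove _ i]
    simp [Fin.insertNthEquiv]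
  have h2 : ∀ (w : Fin k → Fin q) (a : Fin q),
      (Fin.insertNthEquiv (fun _ => Fin q) i (a, w)) i = a := fun w a => by
    simp [Fin.insertNthEquiv]
  simp only [h, h2, prod_letterNorm_of_card_le]
  rw [Finset.prod_ite, Finset.prod_const, Finset.prod_const_one, mul_one,
    card_filter_card_wordSupp_eq]

lemma prod_lowWord_letterNorm {q n t : ℕ} [NeZero q] (hn : 1 ≤ n) :
    ∏ u : LowWord q n t, ∏ i, letterNorm (u.1 i)
      = (q : ℝ) ^ (n * ((n - 1).choose t * (q - 1) ^ t)) := by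
  classical
  obtain ⟨k, rfl⟩ := Nat.exists_eq_add_of_le' hn
  rw [Finset.prod_comm]
  have h : ∀ i : Fin (k + 1), ∏ u : LowWord q (k + 1) t, letterNorm (u.1 i)
      = (q : ℝ) ^ (k.choose t * (q - 1) ^ t) := fun i => by
    rw [← prod_letterNorm_coord q k t i, ← Finset.prod_filter]
    exact (Finset.prod_subtype (p := fun u : Fin (k + 1) → Fin q => (wordSupp u).card ≤ t)
      _ (by simp) fun u => letterNorm (u i)).symm
  rw [Finset.prod_congr rfl fun i _ => h i, Finset.prod_const, Finset.card_univ, Fintype.card_fin,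
    ← pow_mul, Nat.add_sub_cancel, mul_comm]

lemma sum_wordFn {q n : ℕ} [NeZero q] (u : Fin n → Fin q) :
    ∑ x, wordFn u x = (q : ℝ) ^ (n - (wordSupp u).card) := by
  have h : ∑ x, wordFn u x = ∏ i, ∑ b, letterFn (u i) b := by
    rw [Finset.prod_univ_sum, Fintype.piFinset_univ]
    rfl
  have h2 : ∀ a : Fin q, ∑ b, letterFn a b = if a = 0 then (q : ℝ) else 1 := fun a => by
    by_cases ha : a = 0 <;> simp [letterFn, ha]
  have h3 : (Finset.univ.filter fun i => u i = 0) = (wordSupp u)ᶜ := by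
    ext i; simp [wordSupp]
  rw [h]
  simp only [h2]
  rw [Finset.prod_ite, Finset.prod_const, Finset.prod_const_one, mul_one, h3,
    Finset.card_compl, Fintype.card_fin]

lemma isOrthogonalArray_univ {q n t : ℕ} (ht : t ≤ n) :
    IsOrthogonalArray q n t Finset.univ := by
  classical
  intro idx hidx val
  let e := Equiv.ofInjective idx hidx
  let R : Fin n → Finset (Fin q) := fun i =>
    if h : i ∈ Set.range idx then {val (e.symm ⟨i, h⟩)} else Finset.univ
  have h : (Finset.univ.filter fun x : Fin n → Fin q => ∀ j, x (idx j) = val j)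
      = Fintype.piFinset R := by
    ext x
    simp only [Finset.mem_filter, Finset.mem_univ, true_and, Fintype.mem_piFinset]
    constructor
    · intro hx i
      by_cases hi : i ∈ Set.range idx
      · obtain ⟨j, rfl⟩ := hi
        simp [R, e, hx j]
      · simp only [R, dif_neg hi, Finset.mem_univ]
    · intro hx j
      simpa [R, e] using hx (idx j)
  have h2 : ∀ i, (R i).card = if i ∈ Finset.univ.image idx then 1 else q := fun i => by
    by_cases hi : i ∈ Set.range idx
    · rw [if_pos (by simpa using hi)]
      simp only [R, dif_pos hi, Finset.card_singleton]
    · rw [if_neg (by simpa using hi)]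
      simp only [R, dif_neg hi, Finset.card_univ, Fintype.card_fin]
  have h3 : (Finset.univ.filter fun i => i ∉ Finset.univ.image idx).card = n - t := by
    rw [← Finset.compl_filter, Finset.filter_mem_eq_inter, Finset.univ_inter, Finset.card_compl,
      Finset.card_image_of_injective _ hidx, Fintype.card_fin, Finset.card_univ, Fintype.card_fin]
  rw [h, Fintype.card_piFinset]
  simp only [h2]
  rw [Finset.prod_ite, Finset.prod_const_one, one_mul, Finset.prod_const, h3, ← pow_add,
    Nat.sub_add_cancel ht]
  simp

lemma sum_wordFn_of_isOrthogonalArray {q n t : ℕ} [NeZero q] (ht : t ≤ n) (u : LowWord q n t) :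
    ∃ s : ℝ, ∀ T : Finset (Fin n → Fin q), IsOrthogonalArray q n t T →
      ∑ x ∈ T, wordFn u.1 x = s * T.card := by
  classical
  obtain ⟨S, hS, hc⟩ := Finset.exists_superset_card_eq (s := wordSupp u.1) u.2 (by simpa using ht)
  let idx := S.orderEmbOfFin hc
  have hr : Set.range idx = S := Finset.range_orderEmbOfFin S hc
  let g : (Fin t → Fin q) → ℝ := fun w => if ∀ j, u.1 (idx j) = 0 ∨ w j = u.1 (idx j) then 1 else 0
  have hg : ∀ x, wordFn u.1 x = g fun j => x (idx j) := fun x => by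
    rw [wordFn_eq_ite]
    refine if_congr ⟨fun h j => h _, fun h i => ?_⟩ rfl rfl
    by_cases hi : u.1 i = 0
    · exact Or.inl hi
    · have : i ∈ Set.range idx := by
        rw [hr]; exact hS (mem_wordSupp.2 hi)
      obtain ⟨j, rfl⟩ := this
      exact h j
  have hq : ((q : ℝ) ^ t) ≠ 0 := pow_ne_zero _ (by exact_mod_cast NeZero.ne q)
  refine ⟨(∑ w, g w) / (q : ℝ) ^ t, fun T hT => ?_⟩
  have h1 : ∀ w : Fin t → Fin q,
      ((T.filter fun x => (fun j => x (idx j)) = w).card : ℝ) = T.card / (q : ℝ) ^ t := fun w => by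
    rw [eq_div_iff hq]
    have := hT idx idx.injective w
    simp only [funext_iff]
    exact_mod_cast this
  rw [← Finset.sum_fiberwise T (fun x j => x (idx j))]
  have h2 : ∀ w : Fin t → Fin q,
      ∑ x ∈ T.filter (fun x => (fun j => x (idx j)) = w), wordFn u.1 x
        = g w * (T.card / (q : ℝ) ^ t) := fun w => by
    rw [Finset.sum_congr rfl fun x hx => by rw [hg, (Finset.mem_filter.1 hx).2],
      Finset.sum_const, nsmul_eq_mul, h1, mul_comm]
  rw [Finset.sum_congr rfl fun w _ => h2 w, ← Finset.sum_mul]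
  ring

/-- The coefficients expressing the indicator of the letter `v` through `letterFn`. -/
def indicatorCoeff {q : ℕ} [NeZero q] (v a : Fin q) : ℝ :=
  if v = 0 then (if a = 0 then 1 else -1) else (if a = v then 1 else 0)

lemma sum_indicatorCoeff_mul {q : ℕ} [NeZero q] (v b : Fin q) :
    ∑ a, indicatorCoeff v a * letterFn a b = if b = v then 1 else 0 := by
  by_cases hv : v = 0
  · have h : ∀ a, indicatorCoeff v a * letterFn a b
        = (if a = 0 then 2 else 0) - letterFn a b + (if a = 0 then letterFn a b - 1 else 0) := by
      intro a
      by_cases ha : a = 0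
      · simp [indicatorCoeff, hv, ha, letterFn]; norm_num
      · simp [indicatorCoeff, hv, ha]
    have h2 : ∀ a, letterFn a b = (if a = 0 then 1 else 0) + (if b = a then 1 else 0)
        - (if a = 0 then if b = 0 then 1 else 0 else 0) := by
      intro a
      by_cases ha : a = 0
      · subst ha
        by_cases hb : b = 0 <;> simp [letterFn, hb]
      · simp [letterFn, ha]
    subst hv
    simp only [h, Finset.sum_add_distrib, Finset.sum_sub_distrib, Finset.sum_ite_eq',
      Finset.mem_univ, if_true]
    simp only [h2, Finset.sum_add_distrib, Finset.sum_sub_distrib, Finset.sum_ite_eq',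
      Finset.sum_ite_eq, Finset.mem_univ, if_true]
    by_cases hb : b = 0
    · simp [hb]; norm_num
    · simp [hb]
      norm_num
  · rw [Finset.sum_eq_single v]
    · simp [indicatorCoeff, hv, letterFn]
    · intro a _ ha
      simp [indicatorCoeff, hv, ha]
    · simp

lemma exists_sum_wordFn_eq_indicator {q n t : ℕ} [NeZero q] {idx : Fin t → Fin n}
    (hidx : Function.Injective idx) (val : Fin t → Fin q) :
    ∃ c : (Fin n → Fin q) → ℝ, (∀ v, c v ≠ 0 → (wordSupp v).card ≤ t) ∧
      ∀ x, ∑ v, c v * wordFn v x = if ∀ j, x (idx j) = val j then 1 else 0 := by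
  classical
  let e := Equiv.ofInjective idx hidx
  let d : Fin n → Fin q → ℝ := fun i a =>
    if h : i ∈ Set.range idx then indicatorCoeff (val (e.symm ⟨i, h⟩)) a
    else if a = 0 then 1 else 0
  refine ⟨fun v => ∏ i, d i (v i), fun v hv => ?_, fun x => ?_⟩
  · have hsub : wordSupp v ⊆ Finset.univ.image idx := fun i hi => by
      by_contra hn
      have hn' : i ∉ Set.range idx := by simpa using hn
      refine Finset.prod_ne_zero_iff.1 hv i (Finset.mem_univ i) ?_
      simp only [d, dif_neg hn', if_neg (mem_wordSupp.1 hi)]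
    refine (Finset.card_le_card hsub).trans (Finset.card_image_le.trans ?_)
    simp
  · have h1 : ∑ v, (∏ i, d i (v i)) * wordFn v x = ∏ i, ∑ a, d i a * letterFn a (x i) := by
      rw [Finset.prod_univ_sum, Fintype.piFinset_univ]
      exact Finset.sum_congr rfl fun v _ => Finset.prod_mul_distrib.symm
    have h2 : ∀ j, ∑ a, d (idx j) a * letterFn a (x (idx j))
        = if x (idx j) = val j then 1 else 0 := fun j => by
      have : ∀ a, d (idx j) a = indicatorCoeff (val j) a := fun a => by simp [d, e]
      simp only [this, sum_indicatorCoeff_mul]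
    rw [h1]
    split_ifs with h
    · refine Finset.prod_eq_one fun i _ => ?_
      by_cases hi : i ∈ Set.range idx
      · obtain ⟨j, rfl⟩ := hi
        rw [h2, if_pos (h j)]
      · have : ∀ a, d i a = if a = 0 then 1 else 0 := fun a => dif_neg hi
        simp [this, letterFn_zero_left]
    · obtain ⟨j, hj⟩ := not_forall.1 h
      exact Finset.prod_eq_zero (Finset.mem_univ (idx j)) (by rw [h2, if_neg hj])

lemma isOrthogonalArray_iff {q n t N : ℕ} [NeZero q] (ht : t ≤ n) (T : Finset (Fin n → Fin q)) :
    IsOrthogonalArray q n t T ∧ T.card = N ↔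
      ∀ u, ∑ x ∈ T, lowFn q n t u x = (N : ℝ) / (q : ℝ) ^ n * ∑ x, lowFn q n t u x := by
  classical
  have hq : ((q : ℝ) ^ n) ≠ 0 := pow_ne_zero _ (by exact_mod_cast NeZero.ne q)
  constructor
  · rintro ⟨hT, rfl⟩ u
    obtain ⟨s, hs⟩ := sum_wordFn_of_isOrthogonalArray ht u
    have h := hs _ (isOrthogonalArray_univ ht)
    simp only [lowFn]
    rw [h, hs T hT]
    simp only [Finset.card_univ, Fintype.card_pi, Fintype.card_fin, Finset.prod_const,
      Nat.cast_pow]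
    field_simp
  · intro h
    have hc : T.card = N := by
      have h0 := h ⟨fun _ => 0, by simp [wordSupp]⟩
      simp only [lowFn, wordFn, letterFn_zero_left, Finset.prod_const_one, Finset.sum_const,
        Finset.card_univ, Fintype.card_pi, Fintype.card_fin, Finset.prod_const, nsmul_eq_mul,
        mul_one, Nat.cast_pow, div_mul_cancel₀ _ hq] at h0
      exact_mod_cast h0
    refine ⟨fun idx hidx val => ?_, hc⟩
    obtain ⟨c, hc0, hc1⟩ := exists_sum_wordFn_eq_indicator hidx val
    have hsum : ∀ S : Finset (Fin n → Fin q),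
        ((S.filter fun x => ∀ j, x (idx j) = val j).card : ℝ)
          = ∑ v, c v * ∑ x ∈ S, wordFn v x := fun S => by
      rw [Finset.card_filter]
      push_cast
      rw [Finset.sum_congr rfl fun x _ => (hc1 x).symm, Finset.sum_comm]
      exact Finset.sum_congr rfl fun v _ => Finset.mul_sum _ _ _ |>.symm
    have hT : ((T.filter fun x => ∀ j, x (idx j) = val j).card : ℝ)
        = (N : ℝ) / (q : ℝ) ^ n
          * ((Finset.univ.filter fun x : Fin n → Fin q => ∀ j, x (idx j) = val j).card : ℝ) := by
      rw [hsum, hsum, Finset.mul_sum]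
      refine Finset.sum_congr rfl fun v _ => ?_
      by_cases hv : c v = 0
      · simp [hv]
      · have := h ⟨v, hc0 v hv⟩
        simp only [lowFn] at this
        rw [this]
        ring
    have hu := isOrthogonalArray_univ (q := q) ht idx hidx val
    simp only [Finset.card_univ, Fintype.card_pi, Fintype.card_fin, Finset.prod_const] at hu
    have hu' : ((Finset.univ.filter fun x : Fin n → Fin q => ∀ j, x (idx j) = val j).card : ℝ)
        * (q : ℝ) ^ t = (q : ℝ) ^ n := by exact_mod_cast hu
    rw [hc]
    have : ((T.filter fun x => ∀ j, x (idx j) = val j).card : ℝ) * (q : ℝ) ^ t = N := by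
      rw [hT, mul_assoc, hu', div_mul_cancel₀ _ hq]
    exact_mod_cast this

lemma exists_int_eq_mul_sum_lowFn {q n t N : ℕ} [NeZero q] (hN : q ^ t ∣ N) (u : LowWord q n t) :
    ∃ b : ℤ, (N : ℝ) / (q : ℝ) ^ n * ∑ x, lowFn q n t u x = b := by
  have hq : (q : ℝ) ≠ 0 := by exact_mod_cast NeZero.ne q
  obtain ⟨M, hM⟩ := (pow_dvd_pow q u.2).trans hN
  have hle : (wordSupp u.1).card ≤ n := (Finset.card_le_univ _).trans_eq (Fintype.card_fin n)
  refine ⟨M, ?_⟩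
  simp only [lowFn]
  rw [sum_wordFn, hM, pow_sub₀ _ hq hle]
  push_cast
  field_simp

lemma exists_int_lowFn (q n t : ℕ) [NeZero q] :
    ∃ f : LowWord q n t → (Fin n → Fin q) → ℤ, ∀ u x, lowFn q n t u x = f u x := by
  refine ⟨fun u x => if ∀ i, u.1 i = 0 ∨ x i = u.1 i then 1 else 0, fun u x => ?_⟩
  rw [lowFn, wordFn_eq_ite]
  push_cast
  rfl

lemma ball_le_pow_three {q n t : ℕ} (hq : 2 ≤ q) (ht : 1 ≤ t) (htn : t ≤ n) :
    ((∑ i ∈ Finset.range (t + 1), n.choose i * (q - 1) ^ i : ℕ) : ℝ)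
      ≤ (((q : ℝ) * n / t) ^ t) ^ 3 := by
  set Z : ℝ := (q : ℝ) * n / t with hZ
  have ht0 : (0 : ℝ) < t := by exact_mod_cast ht
  have hn0 : (0 : ℝ) < n := by exact_mod_cast ht.trans htn
  have hq2 : (2 : ℝ) ≤ q := by exact_mod_cast hq
  have htn' : (t : ℝ) ≤ n := by exact_mod_cast htn
  have hZ2 : 2 ≤ Z := by
    rw [hZ, le_div_iff₀ ht0]
    nlinarith
  have hZ0 : 0 < Z := by linarith
  have hx0 : (0 : ℝ) ≤ ((q - 1 : ℕ) : ℝ) / Z := by positivity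
  have h1 : ((∑ i ∈ Finset.range (t + 1), n.choose i * (q - 1) ^ i : ℕ) : ℝ)
      ≤ Z ^ t * (1 + ((q - 1 : ℕ) : ℝ) / Z) ^ n := by
    rw [add_comm 1, add_pow, Finset.mul_sum]
    push_cast
    refine le_trans ?_ (Finset.sum_le_sum_of_subset_of_nonneg
      (Finset.range_mono (Nat.succ_le_succ htn)) fun i _ _ => by positivity)
    refine Finset.sum_le_sum fun i hi => ?_
    have hit : i ≤ t := Nat.lt_succ_iff.1 (Finset.mem_range.1 hi)
    have h2 : Z ^ i ≤ Z ^ t := pow_le_pow_right₀ (by linarith) hit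
    rw [one_pow, mul_one]
    calc (n.choose i : ℝ) * ((q - 1 : ℕ) : ℝ) ^ i
        = Z ^ i * ((((q - 1 : ℕ) : ℝ) / Z) ^ i * n.choose i) := by
          rw [← mul_assoc, ← mul_pow, mul_div_cancel₀ _ hZ0.ne', mul_comm]
      _ ≤ _ := by gcongr
  have h2 : (1 + ((q - 1 : ℕ) : ℝ) / Z) ^ n ≤ (Z ^ t) ^ 2 := by
    have hc : ((q - 1 : ℕ) : ℝ) ≤ q := by exact_mod_cast Nat.sub_le q 1
    have h3 : (n : ℝ) * (((q - 1 : ℕ) : ℝ) / Z) ≤ t := by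
      rw [hZ]
      rw [div_div_eq_mul_div, mul_div_assoc', div_le_iff₀ (by positivity)]
      nlinarith [mul_le_mul_of_nonneg_right hc (mul_pos hn0 ht0).le]
    calc (1 + ((q - 1 : ℕ) : ℝ) / Z) ^ n ≤ (Real.exp (((q - 1 : ℕ) : ℝ) / Z)) ^ n := by
          gcongr
          linarith [Real.add_one_le_exp (((q - 1 : ℕ) : ℝ) / Z)]
      _ = Real.exp (n * (((q - 1 : ℕ) : ℝ) / Z)) := (Real.exp_nat_mul _ _).symm
      _ ≤ Real.exp (t * 1) := by rw [mul_one]; exact Real.exp_le_exp.2 h3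
      _ = Real.exp 1 ^ t := Real.exp_nat_mul _ _
      _ ≤ (Z ^ 2) ^ t := by
          gcongr
          nlinarith [Real.exp_one_lt_d9]
      _ = _ := pow_right_comm _ _ _
  calc _ ≤ _ := h1
    _ ≤ Z ^ t * (Z ^ t) ^ 2 := by gcongr
    _ = _ := by ring

/-- Elementary bounds for quantities attached to `L = (qn/t)^t`. -/
lemma param_bounds {q n t : ℕ} (hq : 2 ≤ q) (ht : 1 ≤ t) (htn : t ≤ n) {L : ℝ}
    (hL : L = ((q : ℝ) * n / t) ^ t) :
    2 ≤ L ∧ (2 : ℝ) ^ t ≤ L ∧ (q : ℝ) ^ t ≤ L ∧ (q : ℝ) * n ≤ L ^ 2 := by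
  subst hL
  set Z : ℝ := (q : ℝ) * n / t with hZ
  have ht0 : (0 : ℝ) < t := by exact_mod_cast ht
  have hq2 : (2 : ℝ) ≤ q := by exact_mod_cast hq
  have htn' : (t : ℝ) ≤ n := by exact_mod_cast htn
  have hqZ : (q : ℝ) ≤ Z := by
    rw [hZ, le_div_iff₀ ht0]
    gcongr
  have hZ2 : 2 ≤ Z := hq2.trans hqZ
  have h2 : (2 : ℝ) ^ t ≤ Z ^ t := by gcongr
  have hZt : Z ≤ Z ^ t := le_self_pow₀ (by linarith) (by omega)
  refine ⟨hZ2.trans hZt, h2, by gcongr, ?_⟩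
  have h3 : (t : ℝ) ≤ 2 ^ t := by exact_mod_cast Nat.lt_two_pow_self.le
  calc (q : ℝ) * n = Z * t := by rw [hZ]; field_simp
    _ ≤ Z ^ t * Z ^ t := by
        gcongr
        exact h3.trans h2
    _ = _ := by ring

lemma error_le {L m J A e : ℝ} (hL : 2 ≤ L) (hm : L ^ 100 ≤ m) (hJ : Real.exp (-L ^ 5) ≤ J)
    (hA : A ≤ Real.exp (L ^ 3)) (hlog : Real.log m ≤ L ^ 2) (he0 : 0 ≤ e) (he : e ≤ m) :
    Real.exp (-(4 * m / L ^ 17 * (L ^ 12 / √m) ^ 2))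
        + Real.exp (-(4 * m / L ^ 17 * (L ^ 12 / √m) ^ 2 / 2)) * (A * J)
        + (Real.exp (e * (2 * Real.pi * (L ^ 12 / √m)) ^ 3) - 1) * J
      ≤ L ^ 100 / √m * J := by
  have hL0 : 0 < L := by linarith
  have hL1 : 1 ≤ L := by linarith
  have hm0 : 0 < m := lt_of_lt_of_le (by positivity) hm
  have hs : 0 < √m := Real.sqrt_pos.2 hm0
  have hss : √m ^ 2 = m := Real.sq_sqrt hm0.le
  have hJ0 : 0 < J := (Real.exp_pos _).trans_le hJ
  have hLs : L ^ 50 ≤ √m := by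
    rw [Real.le_sqrt (by positivity) hm0.le]
    calc (L ^ 50) ^ 2 = L ^ 100 := by ring
      _ ≤ m := hm
  have hexp : 4 * m / L ^ 17 * (L ^ 12 / √m) ^ 2 = 4 * L ^ 7 := by
    rw [div_pow, hss]
    field_simp
  have hsm : Real.exp (-(L ^ 2 / 2)) ≤ 1 / √m := by
    rw [Real.exp_neg, ← one_div]
    refine one_div_le_one_div_of_le hs ?_
    rw [← Real.log_le_iff_le_exp hs, Real.log_sqrt hm0.le]
    linarith
  have h37 : L ^ 3 ≤ L ^ 7 := pow_le_pow_right₀ hL1 (by norm_num)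
  have h27 : L ^ 2 ≤ L ^ 7 := pow_le_pow_right₀ hL1 (by norm_num)
  have h57 : L ^ 5 ≤ L ^ 7 := pow_le_pow_right₀ hL1 (by norm_num)
  have h1 : Real.exp (-(4 * L ^ 7)) ≤ 1 / √m * J := by
    calc Real.exp (-(4 * L ^ 7)) ≤ Real.exp (-(L ^ 2 / 2) + -L ^ 5) :=
          Real.exp_le_exp.2 (by nlinarith)
      _ = Real.exp (-(L ^ 2 / 2)) * Real.exp (-L ^ 5) := Real.exp_add _ _
      _ ≤ _ := by gcongr
  have h2 : Real.exp (-(4 * L ^ 7 / 2)) * (A * J) ≤ 1 / √m * J := by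
    rw [← mul_assoc]
    gcongr
    calc Real.exp (-(4 * L ^ 7 / 2)) * A
        ≤ Real.exp (-(4 * L ^ 7 / 2)) * Real.exp (L ^ 3) := by gcongr
      _ = Real.exp (-(4 * L ^ 7 / 2) + L ^ 3) := (Real.exp_add _ _).symm
      _ ≤ Real.exp (-(L ^ 2 / 2)) := Real.exp_le_exp.2 (by nlinarith)
      _ ≤ _ := hsm
  have hpi : (2 * Real.pi) ^ 3 ≤ L ^ 9 := by
    calc (2 * Real.pi) ^ 3 ≤ (2 * 4) ^ 3 := by
          gcongr
          exact Real.pi_le_four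
      _ = 2 ^ 9 := by norm_num
      _ ≤ L ^ 9 := by gcongr
  have he1 : e * (2 * Real.pi * (L ^ 12 / √m)) ^ 3 ≤ L ^ 45 / √m := by
    calc e * (2 * Real.pi * (L ^ 12 / √m)) ^ 3
        = e * ((2 * Real.pi) ^ 3 * (L ^ 36 / √m ^ 3)) := by
          rw [mul_pow, div_pow]
          ring
      _ ≤ m * (L ^ 9 * (L ^ 36 / √m ^ 3)) := by gcongr
      _ = √m ^ 2 * (L ^ 9 * (L ^ 36 / √m ^ 3)) := by rw [hss]
      _ = L ^ 45 / √m := by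
          field_simp
  have he2 : L ^ 45 / √m ≤ 1 := by
    rw [div_le_one hs]
    exact (pow_le_pow_right₀ hL1 (by norm_num)).trans hLs
  have he3 : 0 ≤ e * (2 * Real.pi * (L ^ 12 / √m)) ^ 3 := by positivity
  have h3 : Real.exp (e * (2 * Real.pi * (L ^ 12 / √m)) ^ 3) - 1 ≤ 2 * (L ^ 45 / √m) := by
    refine (le_abs_self _).trans ((Real.abs_exp_sub_one_le ?_).trans ?_)
    · rw [abs_of_nonneg he3]
      exact he1.trans he2
    · rw [abs_of_nonneg he3]
      gcongr
  rw [hexp]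
  calc _ ≤ 1 / √m * J + 1 / √m * J + 2 * (L ^ 45 / √m) * J := by gcongr
    _ = (2 + 2 * L ^ 45) / √m * J := by ring
    _ ≤ L ^ 100 / √m * J := by
        gcongr
        have h1 : L ^ 47 ≤ L ^ 100 := pow_le_pow_right₀ hL1 (by norm_num)
        have h45 : 1 ≤ L ^ 45 := one_le_pow₀ hL1
        have h47 : L ^ 47 = L ^ 45 * L ^ 2 := by ring
        have h4 : 4 ≤ L ^ 2 := by nlinarith
        have := mul_le_mul_of_nonneg_left h4 (zero_le_one.trans h45)
        linarith

lemma decode_le {q n t : ℕ} [NeZero q] (hq : 2 ≤ q) (ht : 1 ≤ t) (htn : t ≤ n) {L : ℝ}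
    (hL : L = ((q : ℝ) * n / t) ^ t) {G : Type*} [SeminormedAddCommGroup G] (ρ : ℝ →+ G)
    (θ : LowWord q n t → ℝ) :
    (q : ℝ) ^ n * (∑ u, ‖ρ (θ u)‖) ^ 2 ≤ L ^ 17 * ∑ z, ‖ρ (combo (lowFn q n t) θ z)‖ ^ 2 := by
  obtain ⟨hL2, h2t, hqt, -⟩ := param_bounds hq ht htn hL
  have hD : (Fintype.card (LowWord q n t) : ℝ) ≤ L ^ 3 := by
    rw [card_lowWord, hL]
    exact ball_le_pow_three hq ht htn
  have hE : ((Finset.univ.filter fun E : Finset (Fin n) => E.card ≤ t).card : ℝ) ≤ L ^ 3 := by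
    refine le_trans ?_ hD
    rw [card_filter_card_le, card_lowWord]
    norm_cast
    exact Finset.sum_le_sum fun i _ => Nat.le_mul_of_pos_right _ (pow_pos (by omega) _)
  have h4 : (4 : ℝ) ^ t ≤ L ^ 2 := by
    calc (4 : ℝ) ^ t = (2 ^ t) ^ 2 := by rw [pow_right_comm]; norm_num
      _ ≤ L ^ 2 := by gcongr
  refine (sum_norm_map_coeff_sq_le ρ θ).trans ?_
  refine mul_le_mul_of_nonneg_right ?_ (Finset.sum_nonneg fun _ _ => by positivity)
  calc _ ≤ (L ^ 3 * L ^ 2 * L ^ 3) ^ 2 * L := by gcongr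
    _ = L ^ 17 := by ring

lemma sum_filter_eq_natCard_mul {q n t N : ℕ} [NeZero q] (htn : t ≤ n)
    [DecidablePred fun T : Finset (Fin n → Fin q) => ∀ u, ∑ x ∈ T, lowFn q n t u x
      = (N : ℝ) / (q : ℝ) ^ n * ∑ x, lowFn q n t u x] (a b : ℝ) :
    (∑ T : Finset (Fin n → Fin q) with ∀ u, ∑ x ∈ T, lowFn q n t u x
      = (N : ℝ) / (q : ℝ) ^ n * ∑ x, lowFn q n t u x, a ^ T.card * b ^ Tᶜ.card)
      = Nat.card {T : Finset (Fin n → Fin q) // IsOrthogonalArray q n t T ∧ T.card = N}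
        * (a ^ N * b ^ (q ^ n - N)) := by
  classical
  have h : ∀ T ∈ Finset.univ.filter (fun T : Finset (Fin n → Fin q) => ∀ u,
      ∑ x ∈ T, lowFn q n t u x = (N : ℝ) / (q : ℝ) ^ n * ∑ x, lowFn q n t u x),
      a ^ T.card * b ^ Tᶜ.card = a ^ N * b ^ (q ^ n - N) := by
    intro T hT
    have hc := ((isOrthogonalArray_iff htn T).2 (Finset.mem_filter.1 hT).2).2
    rw [Finset.card_compl, hc]
    simp
  rw [Finset.sum_congr rfl h, Finset.sum_const, nsmul_eq_mul, Nat.card_eq_fintype_card,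
    Fintype.card_subtype]
  congr 2
  simp only [isOrthogonalArray_iff htn]

/-- The Gaussian approximation to the probability that a random set of density `p` is an
orthogonal array. -/
noncomputable def gaussMass (q n t : ℕ) (p : ℝ) : ℝ :=
  (2 * Real.pi * p * (1 - p))
      ^ (-((∑ i ∈ Finset.range (t + 1), n.choose i * (q - 1) ^ i : ℕ) : ℝ) / 2)
    * ((q : ℝ) ^ (n * ((n - 1).choose t * (q - 1) ^ t))) ^ (-(1 / 2) : ℝ)

lemma gaussFn_lowFn {q n t : ℕ} [NeZero q] (hn : 1 ≤ n) {v : ℝ} (hv : 0 < v) :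
    Integrable (gaussFn (lowFn q n t) v) ∧
      ∫ θ, gaussFn (lowFn q n t) v θ = (2 * Real.pi * v)
        ^ (-((∑ i ∈ Finset.range (t + 1), n.choose i * (q - 1) ^ i : ℕ) : ℝ) / 2)
        * ((q : ℝ) ^ (n * ((n - 1).choose t * (q - 1) ^ t))) ^ (-(1 / 2) : ℝ) := by
  classical
  have h := integral_gaussFn (lowFn q n t) (orthMatrix q n t) (det_orthMatrix q n t)
    (fun u => ∏ i, letterNorm (u.1 i)) (fun u => Finset.prod_pos fun i _ => letterNorm_pos _)
    (sum_combo_orthMatrix_sq q n t) hv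
  rwa [prod_lowWord_letterNorm hn, card_lowWord] at h

lemma exp_le_gaussMass {q n t : ℕ} (hq : 2 ≤ q) (ht : 1 ≤ t) (htn : t ≤ n) {L m p : ℝ}
    (hL : L = ((q : ℝ) * n / t) ^ t) (hp0 : 0 < p) (hp1 : p < 1)
    (hpm : p * (1 - p) * (q : ℝ) ^ n ≤ m) (hm : Real.log m ≤ L ^ 2) :
    Real.exp (-L ^ 5) ≤ gaussMass q n t p := by
  obtain ⟨hL2, -, -, -⟩ := param_bounds hq ht htn hL
  have hD := ball_le_pow_three hq ht htn
  rw [← hL] at hD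
  rw [gaussMass]
  set D : ℕ := ∑ i ∈ Finset.range (t + 1), n.choose i * (q - 1) ^ i with hDdef
  have hq0 : (0 : ℝ) < q := by exact_mod_cast (by omega : 0 < q)
  have hq1 : (1 : ℝ) ≤ q := by exact_mod_cast (by omega : 1 ≤ q)
  have hv : 0 < p * (1 - p) := mul_pos hp0 (by linarith)
  have hpi := Real.pi_pos
  have hAD : (n - 1).choose t * (q - 1) ^ t ≤ D := by
    refine le_trans (Nat.mul_le_mul_right _ (Nat.choose_le_choose t (Nat.sub_le n 1))) ?_
    exact Finset.single_le_sum (f := fun i => n.choose i * (q - 1) ^ i) (fun _ _ => Nat.zero_le _)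
      (Finset.mem_range.2 (Nat.lt_succ_self t))
  have h1 : ((q : ℝ) ^ n) ^ (-(D : ℝ) / 2)
      ≤ ((q : ℝ) ^ (n * ((n - 1).choose t * (q - 1) ^ t))) ^ (-(1 / 2) : ℝ) := by
    have : ((q : ℝ) ^ n) ^ (-(D : ℝ) / 2) = (((q : ℝ) ^ n) ^ D) ^ (-(1 / 2) : ℝ) := by
      rw [← Real.rpow_natCast _ D, ← Real.rpow_mul (by positivity)]
      congr 1
      ring
    rw [this, ← pow_mul]
    exact Real.rpow_le_rpow_of_nonpos (by positivity)
      (pow_le_pow_right₀ hq1 (Nat.mul_le_mul_left n hAD)) (by norm_num)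
  have h2 : (2 * Real.pi * m) ^ (-(D : ℝ) / 2)
      ≤ (2 * Real.pi * p * (1 - p)) ^ (-(D : ℝ) / 2) * ((q : ℝ) ^ n) ^ (-(D : ℝ) / 2) := by
    have hv' : 0 < 2 * Real.pi * p * (1 - p) := by
      rw [mul_assoc]; positivity
    rw [← Real.mul_rpow hv'.le (by positivity)]
    refine Real.rpow_le_rpow_of_nonpos (by positivity) ?_ (by
      have : (0 : ℝ) ≤ D := Nat.cast_nonneg D
      linarith)
    calc _ = 2 * Real.pi * (p * (1 - p) * (q : ℝ) ^ n) := by ring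
      _ ≤ _ := by gcongr
  have hm0 : 0 < m := lt_of_lt_of_le (by positivity) hpm
  have h3 : Real.log (2 * Real.pi * m) ≤ 2 * L ^ 2 := by
    rw [Real.log_mul (by positivity) hm0.ne']
    have h4 : Real.log (2 * Real.pi) ≤ 3 := by
      rw [Real.log_le_iff_le_exp (by positivity)]
      have h5 : Real.exp 3 = Real.exp 1 ^ 3 := by rw [← Real.exp_nat_mul]; norm_num
      have h6 : (2 : ℝ) ^ 3 ≤ Real.exp 1 ^ 3 := by
        gcongr
        linarith [Real.exp_one_gt_d9]
      rw [h5]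
      linarith [Real.pi_le_four]
    nlinarith
  refine le_trans ?_ (h2.trans (mul_le_mul_of_nonneg_left h1 (Real.rpow_nonneg ?_ _)))
  · rw [Real.rpow_def_of_pos (by positivity)]
    refine Real.exp_le_exp.2 ?_
    have h7 : Real.log (2 * Real.pi * m) * D ≤ 2 * L ^ 2 * L ^ 3 :=
      (mul_le_mul_of_nonneg_right h3 (Nat.cast_nonneg D)).trans
        (mul_le_mul_of_nonneg_left hD (by positivity))
    nlinarith
  · rw [mul_assoc]
    positivity

lemma abs_natCard_mul_sub_le {q n t N : ℕ} (hq : 2 ≤ q) (ht : 1 ≤ t) (htn : t ≤ n)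
    (hdvd : q ^ t ∣ N) {L p m : ℝ} (hL : L = ((q : ℝ) * n / t) ^ t)
    (hm : m = ((min N (q ^ n - N) : ℕ) : ℝ)) (hLm : L ^ 100 ≤ m)
    (hp : p = (N : ℝ) / (q : ℝ) ^ n) (hp0 : 0 < p) (hp1 : p < 1) :
    |Nat.card {T : Finset (Fin n → Fin q) // IsOrthogonalArray q n t T ∧ T.card = N}
        * (p ^ N * (1 - p) ^ (q ^ n - N)) - gaussMass q n t p|
      ≤ L ^ 100 / √m * gaussMass q n t p := by
  classical
  have : NeZero q := ⟨by omega⟩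
  obtain ⟨hL2, -, -, hqn⟩ := param_bounds hq ht htn hL
  have hL0 : 0 < L := by linarith
  have hm0 : 0 < m := lt_of_lt_of_le (by positivity) hLm
  have hs : 0 < √m := Real.sqrt_pos.2 hm0
  have hv : 0 < p * (1 - p) := mul_pos hp0 (by linarith)
  have hpi3 := Real.pi_gt_three
  have hQ : (0 : ℝ) < (q : ℝ) ^ n := by
    have : (0 : ℝ) < q := by exact_mod_cast (by omega : 0 < q)
    positivity
  have hNQ : N ≤ q ^ n := by
    by_contra h
    rw [hm, Nat.sub_eq_zero_of_le (by omega)] at hm0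
    simp at hm0
  have hNp : (N : ℝ) = p * (q : ℝ) ^ n := by rw [hp]; field_simp
  have hmin : m = min (p * (q : ℝ) ^ n) ((1 - p) * (q : ℝ) ^ n) := by
    rw [hm, Nat.cast_min, Nat.cast_sub hNQ, hNp]
    push_cast
    ring_nf
  have hm1 : m ≤ p * (q : ℝ) ^ n := hmin ▸ min_le_left _ _
  have hm2 : m ≤ (1 - p) * (q : ℝ) ^ n := hmin ▸ min_le_right _ _
  have hνm : p * (1 - p) * (q : ℝ) ^ n ≤ m := by
    rw [hmin]
    refine le_min ?_ ?_
    · nlinarith [mul_pos hp0 hQ]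
    · nlinarith [mul_pos (sub_pos.2 hp1) hQ]
  have hmν : m ≤ 2 * (p * (1 - p) * (q : ℝ) ^ n) := by
    rcases le_total p (1 / 2) with h | h
    · nlinarith [mul_pos hp0 hQ]
    · nlinarith [mul_pos (sub_pos.2 hp1) hQ]
  have hlog : Real.log m ≤ L ^ 2 := by
    have h1 : Real.log m ≤ n * Real.log q := by
      rw [← Real.log_pow]
      exact Real.log_le_log hm0 (by nlinarith)
    have h2 : Real.log q ≤ q := (Real.log_le_self (Nat.cast_nonneg q))
    have h3 : (n : ℝ) * Real.log q ≤ n * q := by gcongr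
    linarith
  have hJ := exp_le_gaussMass hq ht htn hL hp0 hp1 hνm hlog
  have hA : ∫ θ, gaussFn (lowFn q n t) (p * (1 - p) / 2) θ
      ≤ (2 : ℝ) ^ ((Fintype.card (LowWord q n t) : ℝ) / 2) * gaussMass q n t p := by
    rw [(gaussFn_lowFn (ht.trans htn) (half_pos hv)).2, gaussMass, card_lowWord]
    rw [show 2 * Real.pi * (p * (1 - p) / 2) = (2 * Real.pi * p * (1 - p)) / 2 by ring,
      Real.div_rpow (by rw [mul_assoc]; positivity) (by norm_num), neg_div,
      Real.rpow_neg (x := 2) (by norm_num), div_inv_eq_mul,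
      mul_right_comm, mul_comm]
  have hAle : (2 : ℝ) ^ ((Fintype.card (LowWord q n t) : ℝ) / 2) ≤ Real.exp (L ^ 3) := by
    have hD := ball_le_pow_three hq ht htn
    rw [← hL, ← card_lowWord] at hD
    rw [Real.rpow_def_of_pos (by norm_num)]
    refine Real.exp_le_exp.2 ?_
    have : Real.log 2 ≤ 1 := by linarith [Real.log_two_lt_d9]
    have h0 : (0 : ℝ) ≤ Fintype.card (LowWord q n t) := Nat.cast_nonneg _
    nlinarith
  have hcoef : ∀ {S T c : ℝ}, 4 ≤ c → 0 ≤ S → (q : ℝ) ^ n * T ≤ L ^ 17 * S →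
      4 * m / L ^ 17 * T ≤ 2 * c * (p * (1 - p)) * S := by
    intro S T c hc hS hT
    rw [div_mul_eq_mul_div, div_le_iff₀ (by positivity)]
    refine le_of_mul_le_mul_right ?_ hQ
    calc 4 * m * T * (q : ℝ) ^ n = 4 * m * ((q : ℝ) ^ n * T) := by ring
      _ ≤ 4 * m * (L ^ 17 * S) := by gcongr
      _ ≤ c * (2 * (p * (1 - p) * (q : ℝ) ^ n)) * (L ^ 17 * S) := by gcongr
      _ = _ := by ring
  have hmain := norm_integral_charFn_sub_le (φ := lowFn q n t) (p := p) (r := L ^ 12 / √m)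
    (κ := 4 * m / L ^ 17) (J := gaussMass q n t p)
    (fun u x => abs_wordFn_le u.1 x) hp0 hp1
    (fun v hv => (gaussFn_lowFn (ht.trans htn) hv).1)
    (by rw [(gaussFn_lowFn (ht.trans htn) hv).2, gaussMass, ← mul_assoc])
    hA (by positivity) (by positivity) ?_ ?_ ?_
  · choose b hb using exists_int_eq_mul_sum_lowFn (n := n) (t := t) hdvd
    obtain ⟨f, hf⟩ := exists_int_lowFn q n t
    rw [integral_charFn _ p f hf b (by rw [hp]; exact hb)] at hmain
    subst hp
    rw [sum_filter_eq_natCard_mul htn, ← Complex.ofReal_sub, Complex.norm_real,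
      Real.norm_eq_abs] at hmain
    refine hmain.trans (error_le hL2 hLm hJ hAle hlog (by positivity) ?_)
    simpa using hνm
  · rw [mul_div_assoc', div_le_one hs]
    refine Real.le_sqrt_of_sq_le (le_trans ?_ hLm)
    have h1 : (1 : ℝ) ≤ L := by linarith
    calc (2 * Real.pi * L ^ 12) ^ 2 ≤ (2 ^ 3 * L ^ 12) ^ 2 := by
          gcongr
          linarith [Real.pi_le_four]
      _ ≤ (L ^ 3 * L ^ 12) ^ 2 := by gcongr
      _ = L ^ 30 := by ring
      _ ≤ L ^ 100 := pow_le_pow_right₀ h1 (by norm_num)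
  · intro θ
    have h := decode_le hq ht htn hL (AddMonoidHom.id ℝ) θ
    simp only [AddMonoidHom.id_apply, Real.norm_eq_abs, sq_abs] at h
    exact hcoef (c := Real.pi ^ 2) (by nlinarith) (by positivity) h
  · intro θ
    have h := decode_le hq ht htn hL (QuotientAddGroup.mk' (AddSubgroup.zmultiples (1 : ℝ))) θ
    have hn : ∀ x : ℝ, ‖QuotientAddGroup.mk' (AddSubgroup.zmultiples (1 : ℝ)) x‖
        = |x - round x| := fun x => by
      have := AddCircle.norm_eq (p := 1) (x := x)
      simpa using this
    simp only [hn, sq_abs] at h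
    have := hcoef (c := 4) le_rfl (by positivity) h
    linarith

end OrthArray

/-- The number of orthogonal arrays of alphabet size `q`, length `n`, strength `t` and
size `N` (for `N` a multiple of `q^t` with `min(N, q^n − N) ≥ (cqn/t)^(ct)`) equals
`q^(−(1/2)n·C(n−1,t)(q−1)^t) / ((2πp(1−p))^((1/2)Σ_{i≤t} C(n,i)(q−1)^i) p^N (1−p)^(q^n−N))`
up to a factor `1+δ` with `|δ| ≤ (cqn/t)^(ct)/√(min(N, q^n−N))`, where `p = N/q^n`. -/
theorem count_orthogonal_arrays :
    ∃ c : ℝ, 0 < c ∧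
      ∀ q n t N : ℕ, 2 ≤ q → 1 ≤ n → 1 ≤ t → t ≤ n →
        q ^ t ∣ N →
        (c * q * n / t) ^ (c * t) ≤ ((min N (q ^ n - N) : ℕ) : ℝ) →
        ∃ δ : ℝ,
          |δ| ≤ (c * q * n / t) ^ (c * t) / Real.sqrt ((min N (q ^ n - N) : ℕ) : ℝ) ∧
          (Nat.card {T : Finset (Fin n → Fin q) //
              IsOrthogonalArray q n t T ∧ T.card = N} : ℝ)
            = ((q : ℝ) ^ (-(1 / 2 : ℝ) * n * ((n - 1).choose t : ℝ) * ((q - 1 : ℕ) : ℝ) ^ t))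
                  / ((2 * Real.pi * ((N : ℝ) / (q : ℝ) ^ n) * (1 - (N : ℝ) / (q : ℝ) ^ n))
                        ^ ((1 / 2 : ℝ) *
                            ∑ i ∈ Finset.range (t + 1), (n.choose i : ℝ) * ((q - 1 : ℕ) : ℝ) ^ i)
                      * ((N : ℝ) / (q : ℝ) ^ n) ^ N
                      * (1 - (N : ℝ) / (q : ℝ) ^ n) ^ (q ^ n - N))
              * (1 + δ) := by
  refine ⟨100, by norm_num, fun q n t N hq hn ht htn hdvd hbig => ?_⟩
  have hq0 : (0 : ℝ) < q := by exact_mod_cast (by omega : 0 < q)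
  have ht0 : (0 : ℝ) < t := by exact_mod_cast ht
  have hn0 : (0 : ℝ) < n := by exact_mod_cast hn
  have hpow : (((q : ℝ) * n / t) ^ t) ^ 100 ≤ (100 * (q : ℝ) * n / t) ^ ((100 : ℝ) * t) := by
    have h : (100 : ℝ) * t = ((t * 100 : ℕ) : ℝ) := by push_cast; ring
    rw [h, Real.rpow_natCast, ← pow_mul]
    gcongr
    linarith
  have hLm := hpow.trans hbig
  have hmpos : (0 : ℝ) < ((min N (q ^ n - N) : ℕ) : ℝ) := lt_of_lt_of_le (by positivity) hLm
  have hmpos' : 0 < min N (q ^ n - N) := by exact_mod_cast hmpos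
  have hN0 : (0 : ℝ) < N := by exact_mod_cast (lt_min_iff.1 hmpos').1
  have hNQ : (N : ℝ) < (q : ℝ) ^ n := by exact_mod_cast Nat.sub_pos_iff_lt.1 (lt_min_iff.1 hmpos').2
  obtain ⟨p, hp⟩ : ∃ p, p = (N : ℝ) / (q : ℝ) ^ n := ⟨_, rfl⟩
  have hp0 : 0 < p := by rw [hp]; positivity
  have hp1 : p < 1 := by rw [hp, div_lt_one (by positivity)]; exact hNQ
  have hp1' : 0 < 1 - p := by linarith
  have key := OrthArray.abs_natCard_mul_sub_le hq ht htn hdvd rfl rfl hLm hp hp0 hp1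
  rw [← hp]
  have hK : 0 < p ^ N * (1 - p) ^ (q ^ n - N) := by positivity
  have hY : 0 < 2 * Real.pi * p * (1 - p) := by positivity
  have hJ : OrthArray.gaussMass q n t p
      = (q : ℝ) ^ (-(1 / 2 : ℝ) * n * ((n - 1).choose t : ℝ) * ((q - 1 : ℕ) : ℝ) ^ t)
        / (2 * Real.pi * p * (1 - p)) ^ ((1 / 2 : ℝ) *
          ∑ i ∈ Finset.range (t + 1), (n.choose i : ℝ) * ((q - 1 : ℕ) : ℝ) ^ i) := by
    rw [OrthArray.gaussMass, neg_div, Real.rpow_neg hY.le, mul_comm, ← div_eq_mul_inv,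
      ← Real.rpow_natCast, ← Real.rpow_mul hq0.le]
    push_cast
    congr 2 <;> ring
  have hJ0 : 0 < OrthArray.gaussMass q n t p := by rw [hJ]; positivity
  refine ⟨Nat.card {T : Finset (Fin n → Fin q) // IsOrthogonalArray q n t T ∧ T.card = N}
    * (p ^ N * (1 - p) ^ (q ^ n - N)) / OrthArray.gaussMass q n t p - 1, ?_, ?_⟩
  · rw [div_sub_one hJ0.ne', abs_div, abs_of_pos hJ0, div_le_iff₀ hJ0]
    refine key.trans ?_
    gcongr
  · rw [mul_assoc (_ ^ _) (p ^ N), ← div_div, ← hJ]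
    field_simp
    ring
end
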